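/- arXiv:1810.07586 — 2 statements merged into one kernel-verified Lean document; each statement's English description precedes it below -/
import Mathlib

section
/- Fix an integer K ≥ 1 and, for each integer i with -K ≤ i ≤ K, fix natural numbers t_i and m_i. For n > 2K, let σ_n(i) = i if 1 ≤ i ≤ K and σ_n(i) = n + i if -K ≤ i ≤ 0. Then there exists a real number L ≥ 0 such that the sequence n ↦ (number of minimal factorizations F ∈ 𝔐_n satisfying T_{σ_n(i)}(F) = t_i and M_{σ_n(i)}(F) = m_i for all -K ≤ i ≤ K) / n^{n-2} converges to L as n → ∞. -/
/-- `F` is a minimal factorization of size `n`, i.e. a factorization of the cycle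
`(1,2,…,n)` (represented as `finRotate n` on `Fin n`, where the element `i ∈ {1,…,n}`
corresponds to the index `i-1 : Fin n`) into `n-1` transpositions: each `F k` is a
transposition and the left-to-right product `τ₁ τ₂ ⋯ τ_{n-1}` (apply `τ₁` first)
equals the cycle. -/
def IsMinFact (n : ℕ) (F : Fin (n - 1) → Equiv.Perm (Fin n)) : Prop :=
  (∀ k, (F k).IsSwap) ∧ (List.ofFn F).reverse.prod = finRotate n

/-- `T(F, x)`: the number of transpositions in `F` moving the element represented by `x`. -/
def Tcount {n : ℕ} (F : Fin (n - 1) → Equiv.Perm (Fin n)) (x : Fin n) : ℕ :=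
  (Finset.univ.filter fun k : Fin (n - 1) => F k x ≠ x).card

/-- `M(F, x)`: the number of indices `1 ≤ k ≤ n-1` with `τ₁⋯τ_{k-1}(x) ≠ τ₁⋯τ_k(x)`,
i.e. the number of transpositions affecting the trajectory of `x` (left-to-right
partial products, so `τ₁⋯τ_k` is the product of the first `k` entries, applied
`τ₁` first). -/
def Mcount {n : ℕ} (F : Fin (n - 1) → Equiv.Perm (Fin n)) (x : Fin n) : ℕ :=
  (Finset.univ.filter fun k : Fin (n - 1) =>
    ((List.ofFn F).take k.val).reverse.prod x ≠
      ((List.ofFn F).take (k.val + 1)).reverse.prod x).card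

section

open Finset Equiv

namespace MinFact

/-- A weight for one point: a function of its `T`-statistic and one of its `M`-statistic. -/
abbrev Weight := (ℕ → ℝ) × (ℕ → ℝ)

/-- Shift of a weight function by one unit. -/
def sh (f : ℕ → ℝ) : ℕ → ℝ := fun k => f (k + 1)

section General

variable {α β : Type*} [DecidableEq α] [DecidableEq β]

/-- Update of the weights when `τ` is the first factor of a factorization. -/
def step (τ : Perm α) (w : α → Weight) : α → Weight := fun x =>
  if τ x ≠ x then (sh (w x).1, sh (w (τ x)).2) else w x

open Classical in
/-- Total weight of the factorizations of `c` into `k` transpositions. -/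
noncomputable def W [Fintype α] : ℕ → Perm α → (α → Weight) → ℝ
  | 0, c, w => if c = 1 then ∏ x, (w x).1 0 * (w x).2 0 else 0
  | k + 1, c, w => ∑ τ : Perm α with τ.IsSwap, W k (c * τ) (step τ w)

/-- `L` is a list of transpositions with left-to-right product `c`. -/
def IsFac (L : List (Perm α)) (c : Perm α) : Prop :=
  (∀ τ ∈ L, τ.IsSwap) ∧ L.reverse.prod = c

lemma swap_apply_apply_of_isSwap {τ : Perm α} (h : τ.IsSwap) (x : α) : τ (τ x) = x := by
  obtain ⟨a, b, -, rfl⟩ := h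
  exact swap_apply_self a b x

lemma mul_self_of_isSwap {τ : Perm α} (h : τ.IsSwap) : τ * τ = 1 := by
  obtain ⟨a, b, -, rfl⟩ := h
  exact swap_mul_self a b

lemma IsFac.cons {L : List (Perm α)} {c τ : Perm α} (h : IsFac L (c * τ)) (hτ : τ.IsSwap) :
    IsFac (τ :: L) c := by
  refine ⟨by simpa using ⟨hτ, h.1⟩, ?_⟩
  rw [List.reverse_cons, List.prod_append, h.2, List.prod_singleton, mul_assoc,
    mul_self_of_isSwap hτ, mul_one]

lemma isSwap_permCongr (e : α ≃ β) (τ : Perm α) : (e.permCongr τ).IsSwap ↔ τ.IsSwap := by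
  constructor
  · rintro ⟨a, b, hab, h⟩
    refine ⟨e.symm a, e.symm b, by simpa using hab, ?_⟩
    ext x
    apply e.injective
    have := congrArg (fun σ => σ (e x)) h
    simp only [permCongr_apply, symm_apply_apply] at this
    rw [this]
    simp [swap_apply_def, apply_ite e, Equiv.eq_symm_apply]
  · rintro ⟨a, b, hab, rfl⟩
    refine ⟨e a, e b, by simpa using hab, ?_⟩
    ext x
    simp [swap_apply_def, apply_ite e, Equiv.symm_apply_eq]

lemma rel_prod {γ : Type*} {r : γ → γ → Prop} (hr : Equivalence r) (L : List (Perm γ))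
    (h : ∀ τ ∈ L, ∀ x, r x (τ x)) (x : γ) : r x (L.reverse.prod x) := by
  induction L generalizing x with
  | nil => exact hr.refl x
  | cons τ L ih =>
    rw [List.reverse_cons, List.prod_append, List.prod_singleton, Perm.mul_apply]
    exact hr.trans (h τ (by simp) x) (ih (fun σ hσ => h σ (by simp [hσ])) _)

/-- A transposition of `α ⊕ β` within one of the two summands. -/
def NonCrossing (τ : Perm (α ⊕ β)) : Prop :=
  (∃ τ₁ : Perm α, τ₁.IsSwap ∧ τ = Perm.sumCongr τ₁ 1) ∨
    ∃ τ₂ : Perm β, τ₂.IsSwap ∧ τ = Perm.sumCongr 1 τ₂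

lemma nonCrossing_or {τ : Perm (α ⊕ β)} (h : τ.IsSwap) :
    NonCrossing τ ∨ ∃ x y, τ (Sum.inl x) = Sum.inr y := by
  obtain ⟨a, b, hab, rfl⟩ := h
  rcases a with a | a <;> rcases b with b | b
  · refine Or.inl (Or.inl ⟨swap a b, ⟨a, b, by simpa using hab, rfl⟩, ?_⟩)
    exact (Perm.sumCongr_swap_one a b).symm
  · exact Or.inr ⟨a, b, swap_apply_left _ _⟩
  · exact Or.inr ⟨b, a, swap_apply_right _ _⟩
  · refine Or.inl (Or.inr ⟨swap a b, ⟨a, b, by simpa using hab, rfl⟩, ?_⟩)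
    exact (Perm.sumCongr_one_swap a b).symm

lemma isSwap_sumCongr_one {τ : Perm α} (h : τ.IsSwap) :
    (Perm.sumCongr τ (1 : Perm β)).IsSwap := by
  obtain ⟨a, b, hab, rfl⟩ := h
  exact ⟨Sum.inl a, Sum.inl b, by simpa using hab, Perm.sumCongr_swap_one a b⟩

lemma isSwap_one_sumCongr {τ : Perm β} (h : τ.IsSwap) :
    (Perm.sumCongr (1 : Perm α) τ).IsSwap := by
  obtain ⟨a, b, hab, rfl⟩ := h
  exact ⟨Sum.inr a, Sum.inr b, by simpa using hab, Perm.sumCongr_one_swap a b⟩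

lemma step_sumCongr_one (τ : Perm α) (w₁ : α → Weight) (w₂ : β → Weight) :
    step (Perm.sumCongr τ 1) (Sum.elim w₁ w₂) = Sum.elim (step τ w₁) w₂ := by
  funext x
  rcases x with x | x <;> simp [step]

lemma step_one_sumCongr (τ : Perm β) (w₁ : α → Weight) (w₂ : β → Weight) :
    step (Perm.sumCongr 1 τ) (Sum.elim w₁ w₂) = Sum.elim w₁ (step τ w₂) := by
  funext x
  rcases x with x | x <;> simp [step]

variable [Fintype α] [Fintype β]

lemma exists_isFac_of_W_ne_zero {k : ℕ} {c : Perm α} {w : α → Weight} (h : W k c w ≠ 0) :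
    ∃ L : List (Perm α), L.length = k ∧ IsFac L c := by
  induction k generalizing c w with
  | zero =>
    refine ⟨[], rfl, by simp, ?_⟩
    by_contra hc
    exact h (by rw [W, if_neg (fun h' => hc (by simp [h']))])
  | succ k ih =>
    rw [W] at h
    obtain ⟨τ, hτ, hne⟩ := Finset.exists_ne_zero_of_sum_ne_zero h
    obtain ⟨L, hL, hf⟩ := ih hne
    exact ⟨τ :: L, by simp [hL], hf.cons (by simpa using hτ)⟩

lemma W_eq_zero_of_weight_eq_zero {k : ℕ} {c : Perm α} {w : α → Weight} {x : α}
    (h : (w x).1 = 0 ∨ (w x).2 = 0) : W k c w = 0 := by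
  induction k generalizing c w x with
  | zero =>
    rw [W]
    split_ifs
    · refine Finset.prod_eq_zero (Finset.mem_univ x) ?_
      rcases h with h | h <;> simp [h]
    · rfl
  | succ k ih =>
    rw [W]
    refine Finset.sum_eq_zero fun τ hτ => ?_
    have hτ' : τ.IsSwap := by simpa using hτ
    by_cases hx : τ x = x
    · exact ih (x := x) (by simpa [step, hx] using h)
    · rcases h with h | h
      · refine ih (x := x) (Or.inl ?_)
        funext k
        simp [step, hx, sh, h]
      · refine ih (x := τ x) (Or.inr ?_)
        have hx' : x ≠ τ x := fun h => hx h.symm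
        funext k
        simp [step, swap_apply_apply_of_isSwap hτ', hx', sh, h]

lemma W_permCongr (e : α ≃ β) (k : ℕ) (c : Perm α) (w : β → Weight) :
    W k (e.permCongr c) w = W k c (w ∘ e) := by
  induction k generalizing c w with
  | zero =>
    rw [W, W]
    have : e.permCongr c = 1 ↔ c = 1 := by
      rw [← e.permCongr.injective.eq_iff (a := c)]
      have : e.permCongr 1 = 1 := by ext; simp
      rw [this]
    simp only [this]
    congr 1
    exact (Equiv.prod_comp e fun x => (w x).1 0 * (w x).2 0).symm
  | succ k ih =>
    rw [W, W]
    symm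
    refine Finset.sum_equiv e.permCongr (fun τ => by simp [isSwap_permCongr]) fun τ _ => ?_
    rw [← permCongr_mul, ih]
    congr 1
    funext x
    simp [step]

/-- An equivalence relation that is preserved by `k` transpositions and identifies all points
forces the ground set to have at most `k + 1` elements. -/
lemma card_le_length_add_one [Nonempty α] (L : List (Perm α)) (hL : ∀ τ ∈ L, τ.IsSwap)
    (h : ∀ r : α → α → Prop, Equivalence r → (∀ τ ∈ L, ∀ x, r x (τ x)) → ∀ x y, r x y) :
    Fintype.card α ≤ L.length + 1 := by
  let G : SimpleGraph α := SimpleGraph.fromRel fun x y => ∃ τ ∈ L, τ x = y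
  have hG : G.Connected := by
    have : G.Preconnected := by
      intro x y
      refine h G.Reachable G.reachable_is_equivalence (fun τ hτ x => ?_) x y
      by_cases hx : τ x = x
      · rw [hx]
      · refine SimpleGraph.Adj.reachable ?_
        rw [SimpleGraph.fromRel_adj]
        exact ⟨fun h => hx h.symm, Or.inl ⟨τ, hτ, rfl⟩⟩
    exact ⟨this⟩
  have h1 := hG.card_vert_le_card_edgeSet_add_one
  rw [Nat.card_eq_fintype_card] at h1
  refine h1.trans (Nat.add_le_add_right ?_ 1)
  let f : Sym2 α → Perm α := Sym2.lift ⟨fun x y => swap x y, fun x y => swap_comm x y⟩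
  have hmaps : ∀ x y, (∃ τ ∈ L, τ x = y) → x ≠ y → swap x y ∈ L := by
    rintro x y ⟨τ, hτ, rfl⟩ hxy
    obtain ⟨a, b, hab, rfl⟩ := hL τ hτ
    rcases swap_apply_ne_self_iff.1 hxy.symm with ⟨-, rfl | rfl⟩
    · simpa using hτ
    · rw [swap_apply_right, swap_comm]; exact hτ
  have hf : ∀ s ∈ G.edgeSet, f s ∈ L.toFinset := by
    intro s
    induction s with
    | _ x y =>
      intro hs
      rw [SimpleGraph.mem_edgeSet, SimpleGraph.fromRel_adj] at hs
      rw [List.mem_toFinset]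
      rcases hs.2 with h | h
      · exact hmaps x y h hs.1
      · change swap x y ∈ L
        rw [swap_comm]
        exact hmaps y x h hs.1.symm
  have hinj : ∀ s ∈ G.edgeSet, ∀ s' ∈ G.edgeSet, f s = f s' → s = s' := by
    intro s hs s' hs' he
    induction s with
    | _ x y =>
    induction s' with
    | _ x' y' =>
      have he : swap x y = swap x' y' := he
      have hxy : x ≠ y := G.ne_of_adj hs
      have h1 : swap x' y' x = y := by rw [← he, swap_apply_left]
      have h2 : swap x' y' x ≠ x := by rw [h1]; exact hxy.symm
      rcases swap_apply_ne_self_iff.1 h2 with ⟨-, rfl | rfl⟩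
      · rw [swap_apply_left] at h1; rw [h1]
      · rw [swap_apply_right] at h1; rw [h1, Sym2.eq_swap]
  calc Nat.card G.edgeSet = G.edgeSet.ncard := rfl
    _ ≤ (L.toFinset : Set (Perm α)).ncard :=
      Set.ncard_le_ncard_of_injOn f hf hinj (Finset.finite_toSet _)
    _ = L.toFinset.card := Set.ncard_coe_finset _
    _ ≤ L.length := L.toFinset_card_le

open Classical in
lemma W_succ_sum (k : ℕ) (c : Perm (α ⊕ β)) (w : α ⊕ β → Weight)
    (h : ∀ τ : Perm (α ⊕ β), τ.IsSwap → ¬ NonCrossing τ → W k (c * τ) (step τ w) = 0) :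
    W (k + 1) c w =
      (∑ τ : Perm α with τ.IsSwap,
        W k (c * Perm.sumCongr τ 1) (step (Perm.sumCongr τ 1) w)) +
      ∑ τ : Perm β with τ.IsSwap,
        W k (c * Perm.sumCongr 1 τ) (step (Perm.sumCongr 1 τ) w) := by
  set φ : Perm (α ⊕ β) → ℝ := fun τ => W k (c * τ) (step τ w) with hφ
  have hi₁ : Set.InjOn (fun τ : Perm α => Perm.sumCongr τ (1 : Perm β))
      ((Finset.univ.filter fun τ : Perm α => τ.IsSwap : Finset (Perm α)) : Set (Perm α)) := by
    intro σ _ τ _ he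
    have := Perm.sumCongrHom_injective (α := α) (β := β) (a₁ := (σ, 1)) (a₂ := (τ, 1)) he
    simpa using this
  have hi₂ : Set.InjOn (fun τ : Perm β => Perm.sumCongr (1 : Perm α) τ)
      ((Finset.univ.filter fun τ : Perm β => τ.IsSwap : Finset (Perm β)) : Set (Perm β)) := by
    intro σ _ τ _ he
    have := Perm.sumCongrHom_injective (α := α) (β := β) (a₁ := (1, σ)) (a₂ := (1, τ)) he
    simpa using this
  have hd : Disjoint
      ((Finset.univ.filter fun τ : Perm α => τ.IsSwap).image
        fun τ : Perm α => Perm.sumCongr τ (1 : Perm β))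
      ((Finset.univ.filter fun τ : Perm β => τ.IsSwap).image
        fun τ : Perm β => Perm.sumCongr (1 : Perm α) τ) := by
    rw [Finset.disjoint_left]
    intro σ h₁ h₂
    simp only [Finset.mem_image, Finset.mem_filter, Finset.mem_univ, true_and] at h₁ h₂
    obtain ⟨τ₁, ⟨a, b, hab, rfl⟩, rfl⟩ := h₁
    obtain ⟨τ₂, -, he⟩ := h₂
    have := congrArg (fun σ => σ (Sum.inl a)) he
    simp at this
    exact hab this
  have h1 : W (k + 1) c w = ∑ τ : Perm (α ⊕ β) with τ.IsSwap, φ τ := by rw [W]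
  rw [h1]
  change _ = (∑ τ : Perm α with τ.IsSwap, φ (Perm.sumCongr τ 1)) +
    ∑ τ : Perm β with τ.IsSwap, φ (Perm.sumCongr 1 τ)
  rw [← Finset.sum_image hi₁, ← Finset.sum_image hi₂, ← Finset.sum_union hd]
  symm
  refine Finset.sum_subset ?_ ?_
  · intro σ hσ
    simp only [Finset.mem_union, Finset.mem_image, Finset.mem_filter, Finset.mem_univ,
      true_and] at hσ ⊢
    rcases hσ with ⟨τ, hτ, rfl⟩ | ⟨τ, hτ, rfl⟩
    · exact isSwap_sumCongr_one hτ
    · exact isSwap_one_sumCongr hτ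
  · intro σ hσ hn
    simp only [Finset.mem_union, Finset.mem_image, Finset.mem_filter, Finset.mem_univ,
      true_and] at hσ hn
    refine h σ hσ fun hc => hn ?_
    rcases hc with ⟨τ, hτ, rfl⟩ | ⟨τ, hτ, rfl⟩
    · exact Or.inl ⟨τ, hτ, rfl⟩
    · exact Or.inr ⟨τ, hτ, rfl⟩

open Classical in
/-- Shuffle formula: if the factorizations of `c₁ ⊕ c₂` never mix the two summands, then they
are the shuffles of factorizations of `c₁` and of `c₂`. -/
lemma W_sumCongr (k : ℕ) (c₁ : Perm α) (c₂ : Perm β) (w₁ : α → Weight) (w₂ : β → Weight)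
    (h : ∀ L : List (Perm (α ⊕ β)), L.length = k → IsFac L (Perm.sumCongr c₁ c₂) →
      ∀ τ ∈ L, NonCrossing τ) :
    W k (Perm.sumCongr c₁ c₂) (Sum.elim w₁ w₂) =
      ∑ p ∈ antidiagonal k, (k.choose p.1 : ℝ) * (W p.1 c₁ w₁ * W p.2 c₂ w₂) := by
  induction k generalizing c₁ c₂ w₁ w₂ with
  | zero =>
    have : Perm.sumCongr c₁ c₂ = 1 ↔ c₁ = 1 ∧ c₂ = 1 := by
      rw [← Perm.sumCongr_one, ← Prod.mk.injEq]
      exact (Perm.sumCongrHom_injective (α := α) (β := β)).eq_iff (a := (c₁, c₂)) (b := (1, 1))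
    simp only [W, this, Fintype.prod_sum_type, Sum.elim_inl, Sum.elim_inr,
      Finset.Nat.antidiagonal_zero,
      Finset.sum_singleton, Nat.choose_self, Nat.cast_one, one_mul]
    by_cases h1 : c₁ = 1 <;> by_cases h2 : c₂ = 1 <;> simp [h1, h2]
  | succ k ih =>
    rw [W_succ_sum]
    · have e₁ : ∀ τ : Perm α, τ.IsSwap →
          W k (Perm.sumCongr c₁ c₂ * Perm.sumCongr τ 1)
            (step (Perm.sumCongr τ 1) (Sum.elim w₁ w₂)) =
          ∑ p ∈ antidiagonal k,
            (k.choose p.1 : ℝ) * (W p.1 (c₁ * τ) (step τ w₁) * W p.2 c₂ w₂) := by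
        intro τ hτ
        rw [step_sumCongr_one, Perm.sumCongr_mul, mul_one]
        refine ih _ _ _ _ fun L hL hf σ hσ => ?_
        refine h (Perm.sumCongr τ 1 :: L) (by simp [hL]) (IsFac.cons ?_ (isSwap_sumCongr_one hτ))
          σ (by simp [hσ])
        rw [Perm.sumCongr_mul, mul_one]
        exact hf
      have e₂ : ∀ τ : Perm β, τ.IsSwap →
          W k (Perm.sumCongr c₁ c₂ * Perm.sumCongr 1 τ)
            (step (Perm.sumCongr 1 τ) (Sum.elim w₁ w₂)) =
          ∑ p ∈ antidiagonal k,
            (k.choose p.1 : ℝ) * (W p.1 c₁ w₁ * W p.2 (c₂ * τ) (step τ w₂)) := by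
        intro τ hτ
        rw [step_one_sumCongr, Perm.sumCongr_mul, mul_one]
        refine ih _ _ _ _ fun L hL hf σ hσ => ?_
        refine h (Perm.sumCongr 1 τ :: L) (by simp [hL]) (IsFac.cons ?_ (isSwap_one_sumCongr hτ))
          σ (by simp [hσ])
        rw [Perm.sumCongr_mul, mul_one]
        exact hf
      rw [Finset.sum_congr rfl fun τ hτ => e₁ τ (by simpa using hτ),
        Finset.sum_congr rfl fun τ hτ => e₂ τ (by simpa using hτ), Finset.sum_comm,
        Finset.sum_comm (s := Finset.univ.filter fun τ : Perm β => τ.IsSwap),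
        Finset.sum_antidiagonal_choose_succ_mul (fun i j => W i c₁ w₁ * W j c₂ w₂), add_comm]
      congr 1
      · refine Finset.sum_congr rfl fun p _ => ?_
        rw [← Finset.mul_sum, ← Finset.mul_sum, W]
      · refine Finset.sum_congr rfl fun p hp => ?_
        rw [← Finset.mul_sum, ← Finset.sum_mul, W]
        rw [HasAntidiagonal.mem_antidiagonal] at hp
        rw [← hp, Nat.choose_symm_add]
    · intro τ hτ hn
      by_contra h0
      obtain ⟨L, hL, hf⟩ := exists_isFac_of_W_ne_zero h0
      exact hn (h (τ :: L) (by simp [hL]) (hf.cons hτ) τ (by simp))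

end General

section Cycle

lemma val_finRotate (n : ℕ) (i : Fin (n + 1)) :
    (finRotate (n + 1) i : ℕ) = if (i : ℕ) = n then 0 else (i : ℕ) + 1 := by
  rw [coe_finRotate]
  simp [Fin.ext_iff]

lemma rel_of_rel_finRotate {n : ℕ} {r : Fin (n + 1) → Fin (n + 1) → Prop} (hr : Equivalence r)
    (h : ∀ x, r x (finRotate (n + 1) x)) (x y : Fin (n + 1)) : r x y := by
  have key : ∀ k (hk : k < n + 1), r 0 ⟨k, hk⟩ := by
    intro k
    induction k with
    | zero => exact fun _ => hr.refl _
    | succ k ih =>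
      intro hk
      have h1 := h ⟨k, by omega⟩
      have h2 : finRotate (n + 1) ⟨k, by omega⟩ = ⟨k + 1, hk⟩ := by
        ext
        rw [val_finRotate, if_neg (by simp; omega)]
      rw [h2] at h1
      exact hr.trans (ih (by omega)) h1
  exact hr.trans (hr.symm (key x x.2)) (key y y.2)

lemma W_finRotate_eq_zero {n k : ℕ} (hk : k < n) (w : Fin (n + 1) → Weight) :
    W k (finRotate (n + 1)) w = 0 := by
  by_contra h0
  obtain ⟨L, hL, hs, hp⟩ := exists_isFac_of_W_ne_zero h0
  have := card_le_length_add_one L hs fun r hr h =>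
    rel_of_rel_finRotate hr fun x => by rw [← hp]; exact rel_prod hr L h x
  rw [Fintype.card_fin] at this
  omega

lemma W_finRotate_sum (d e : ℕ) (w₁ : Fin (d + 1) → Weight) (w₂ : Fin (e + 1) → Weight) :
    W (d + e) (Perm.sumCongr (finRotate (d + 1)) (finRotate (e + 1))) (Sum.elim w₁ w₂) =
      ((d + e).choose d : ℝ) * (W d (finRotate (d + 1)) w₁ * W e (finRotate (e + 1)) w₂) := by
  rw [W_sumCongr]
  · rw [Finset.sum_eq_single (d, e)]
    · rintro ⟨i, j⟩ hij hne
      rw [HasAntidiagonal.mem_antidiagonal] at hij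
      dsimp only at hij ⊢
      by_cases hi : i < d
      · rw [W_finRotate_eq_zero hi]; ring
      · have : j ≠ e := by
          rintro rfl
          exact hne (by rw [show i = d by omega])
        rw [W_finRotate_eq_zero (show j < e by omega)]; ring
    · intro h
      exact absurd (HasAntidiagonal.mem_antidiagonal (a := (d, e)).2 rfl) h
  · rintro L hL ⟨hs, hp⟩ τ hτ
    rcases nonCrossing_or (hs τ hτ) with h | ⟨x, y, hxy⟩
    · exact h
    exfalso
    have := card_le_length_add_one L hs fun r hr h => by
      have hc : ∀ z, r z (Perm.sumCongr (finRotate (d + 1)) (finRotate (e + 1)) z) :=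
        fun z => by rw [← hp]; exact rel_prod hr L h z
      have hl : ∀ i j, r (Sum.inl i) (Sum.inl j) :=
        rel_of_rel_finRotate (r := fun i j => r (Sum.inl i) (Sum.inl j))
          ⟨fun _ => hr.refl _, hr.symm, hr.trans⟩ fun i => hc (Sum.inl i)
      have hrr : ∀ i j, r (Sum.inr i) (Sum.inr j) :=
        rel_of_rel_finRotate (r := fun i j => r (Sum.inr i) (Sum.inr j))
          ⟨fun _ => hr.refl _, hr.symm, hr.trans⟩ fun i => hc (Sum.inr i)
      have hlr : ∀ i j, r (Sum.inl i) (Sum.inr j) := fun i j =>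
        hr.trans (hl i x) (hr.trans (by rw [← hxy]; exact h τ hτ _) (hrr y j))
      rintro (i | i) (j | j)
      · exact hl i j
      · exact hlr i j
      · exact hr.symm (hlr j i)
      · exact hrr i j
    rw [Fintype.card_sum, Fintype.card_fin, Fintype.card_fin] at this
    omega

/-- Index in the full cycle of the points of the two cycles obtained after removing the
transposition of `a` and `a + 1 + d`. -/
def splitFun (d e a : ℕ) (ha : a ≤ e) : Fin (d + 1) ⊕ Fin (e + 1) → Fin (d + e + 2)
  | Sum.inl i => if (i : ℕ) = 0 then ⟨a + 1 + d, by omega⟩ else ⟨a + i, by omega⟩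
  | Sum.inr i => if (i : ℕ) ≤ a then ⟨i, by omega⟩ else ⟨i + d + 1, by omega⟩

lemma val_splitFun_inl (d e a : ℕ) (ha : a ≤ e) (i : Fin (d + 1)) :
    (splitFun d e a ha (Sum.inl i) : ℕ) = if (i : ℕ) = 0 then a + 1 + d else a + i := by
  rw [splitFun]
  split_ifs <;> rfl

lemma val_splitFun_inr (d e a : ℕ) (ha : a ≤ e) (i : Fin (e + 1)) :
    (splitFun d e a ha (Sum.inr i) : ℕ) = if (i : ℕ) ≤ a then (i : ℕ) else i + d + 1 := by
  rw [splitFun]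
  split_ifs <;> rfl

lemma val_swap {n : ℕ} (x y z : Fin n) :
    (swap x y z : ℕ) = if (z : ℕ) = x then (y : ℕ) else if (z : ℕ) = y then (x : ℕ) else z := by
  simp only [swap_apply_def, Fin.ext_iff]
  split_ifs <;> rfl

lemma splitFun_injective (d e a : ℕ) (ha : a ≤ e) : Function.Injective (splitFun d e a ha) := by
  have hl := val_splitFun_inl d e a ha
  have hr := val_splitFun_inr d e a ha
  rintro (i | i) (j | j) h
  all_goals
    have h' := congrArg Fin.val h
    have hi := i.2
    have hj := j.2
    simp only [hl, hr] at h'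
  · congr 1; ext; split_ifs at h' <;> omega
  · exfalso; split_ifs at h' <;> omega
  · exfalso; split_ifs at h' <;> omega
  · congr 1; ext; split_ifs at h' <;> omega

/-- `splitFun` as an equivalence. -/
noncomputable def splitEquiv (d e a : ℕ) (ha : a ≤ e) :
    Fin (d + 1) ⊕ Fin (e + 1) ≃ Fin (d + e + 2) :=
  Equiv.ofBijective (splitFun d e a ha)
    ((Fintype.bijective_iff_injective_and_card _).2
      ⟨splitFun_injective d e a ha, by simp; omega⟩)

lemma permCongr_splitEquiv (d e a : ℕ) (ha : a ≤ e) :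
    (splitEquiv d e a ha).permCongr (Perm.sumCongr (finRotate (d + 1)) (finRotate (e + 1))) =
      finRotate (d + e + 2) * swap ⟨a, by omega⟩ ⟨a + 1 + d, by omega⟩ := by
  ext x
  obtain ⟨y, rfl⟩ := (splitEquiv d e a ha).surjective x
  rw [permCongr_apply, symm_apply_apply, Perm.mul_apply, val_finRotate]
  rcases y with i | i
  · have hi := i.2
    have h1 := val_finRotate d i
    simp only [Perm.sumCongr_apply, Sum.map_inl, splitEquiv, ofBijective_apply,
      val_splitFun_inl, val_swap]
    generalize (finRotate (d + 1) i : ℕ) = j at h1 ⊢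
    generalize (i : ℕ) = i at hi h1 ⊢
    grind
  · have hi := i.2
    have h1 := val_finRotate e i
    simp only [Perm.sumCongr_apply, Sum.map_inr, splitEquiv, ofBijective_apply,
      val_splitFun_inr, val_swap]
    generalize (finRotate (e + 1) i : ℕ) = j at h1 ⊢
    generalize (i : ℕ) = i at hi h1 ⊢
    grind

/-- Weights on the inner cycle after removing the transposition of `a` and `b`. -/
def inner (w : ℕ → Weight) (a b : ℕ) : ℕ → Weight
  | 0 => (sh (w b).1, sh (w a).2)
  | i + 1 => w (a + 1 + i)

/-- Weights on the outer cycle after removing the transposition of `a` and `b`. -/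
def outer (w : ℕ → Weight) (a b : ℕ) (i : ℕ) : Weight :=
  if i < a then w i else if i = a then (sh (w a).1, sh (w b).2) else w (i + (b - a))

lemma step_swap_comp_splitEquiv (d e a : ℕ) (ha : a ≤ e) (w : ℕ → Weight) :
    (step (swap (⟨a, by omega⟩ : Fin (d + e + 2)) ⟨a + 1 + d, by omega⟩)
        fun i : Fin (d + e + 2) => w i) ∘ splitEquiv d e a ha =
      Sum.elim (fun i : Fin (d + 1) => inner w a (a + 1 + d) i)
        (fun i : Fin (e + 1) => outer w a (a + 1 + d) i) := by
  funext x
  rcases x with ⟨i, hi⟩ | ⟨i, hi⟩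
  · rcases i with _ | i
    · simp [splitEquiv, splitFun, step, inner, Fin.ext_iff]
      omega
    · have h1 : swap (⟨a, by omega⟩ : Fin (d + e + 2)) ⟨a + 1 + d, by omega⟩
          ⟨a + (i + 1), by omega⟩ = ⟨a + (i + 1), by omega⟩ :=
        swap_apply_of_ne_of_ne (by simp) (by simp; omega)
      simp [splitEquiv, splitFun, step, inner, h1]
      congr 1; omega
  · by_cases h : i ≤ a
    · rcases h.lt_or_eq with h' | rfl
      · have h1 : swap (⟨a, by omega⟩ : Fin (d + e + 2)) ⟨a + 1 + d, by omega⟩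
            ⟨i, by omega⟩ = ⟨i, by omega⟩ :=
          swap_apply_of_ne_of_ne (by simp; omega) (by simp; omega)
        simp [splitEquiv, splitFun, step, outer, h1, h, h']
      · simp [splitEquiv, splitFun, step, outer, Fin.ext_iff]
        omega
    · have h1 : swap (⟨a, by omega⟩ : Fin (d + e + 2)) ⟨a + 1 + d, by omega⟩
            ⟨i + d + 1, by omega⟩ = ⟨i + d + 1, by omega⟩ :=
          swap_apply_of_ne_of_ne (by simp; omega) (by simp; omega)
      have h2 : ¬ i < a := by omega
      have h3 : i ≠ a := by omega
      simp [splitEquiv, splitFun, step, outer, h1, h, h2, h3]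
      congr 1; omega

/-- Total weight of the minimal factorizations of the cycle on `n + 1` points. -/
noncomputable def A (w : ℕ → Weight) (n : ℕ) : ℝ :=
  W n (finRotate (n + 1)) fun i : Fin (n + 1) => w i

lemma W_remove_swap (d e a : ℕ) (ha : a ≤ e) (w : ℕ → Weight) :
    W (d + e) (finRotate (d + e + 2) * swap ⟨a, by omega⟩ ⟨a + 1 + d, by omega⟩)
        (step (swap (⟨a, by omega⟩ : Fin (d + e + 2)) ⟨a + 1 + d, by omega⟩)
          fun i : Fin (d + e + 2) => w i) =
      ((d + e).choose d : ℝ) * (A (inner w a (a + 1 + d)) d * A (outer w a (a + 1 + d)) e) := by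
  rw [← permCongr_splitEquiv d e a ha, W_permCongr, step_swap_comp_splitEquiv, W_finRotate_sum]
  rfl

lemma swap_eq_swap_of_lt {n : ℕ} {a b a' b' : Fin n} (h : a < b) (h' : a' < b')
    (he : swap a b = swap a' b') : a = a' ∧ b = b' := by
  have h1 : swap a' b' a = b := by rw [← he, swap_apply_left]
  have h2 : swap a' b' a ≠ a := by rw [h1]; exact h.ne'
  rcases swap_apply_ne_self_iff.1 h2 with ⟨-, rfl | rfl⟩
  · rw [swap_apply_left] at h1; exact ⟨rfl, h1.symm⟩
  · rw [swap_apply_right] at h1; rw [h1] at h'; exact absurd h (not_lt.2 h'.le)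

lemma A_succ (w : ℕ → Weight) (n : ℕ) :
    A w (n + 1) = ∑ p ∈ antidiagonal n, ∑ a ∈ range (p.2 + 1),
      (n.choose p.1 : ℝ) *
        (A (inner w a (a + 1 + p.1)) p.1 * A (outer w a (a + 1 + p.1)) p.2) := by
  rw [A, W, Finset.sum_sigma']
  symm
  refine Finset.sum_bij
    (fun q hq => swap (⟨q.2, by
        simp only [mem_sigma, HasAntidiagonal.mem_antidiagonal, mem_range] at hq; omega⟩ :
          Fin (n + 2))
      ⟨q.2 + 1 + q.1.1, by
        simp only [mem_sigma, HasAntidiagonal.mem_antidiagonal, mem_range] at hq; omega⟩)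
    ?_ ?_ ?_ ?_
  · rintro ⟨⟨d, e⟩, a⟩ hq
    simp only [mem_filter, mem_univ, true_and]
    exact ⟨_, _, by simp [Fin.ext_iff]; omega, rfl⟩
  · rintro ⟨⟨d, e⟩, a⟩ hq ⟨⟨d', e'⟩, a'⟩ hq' he
    simp only [mem_sigma, HasAntidiagonal.mem_antidiagonal, mem_range] at hq hq'
    obtain ⟨h1, h2⟩ := swap_eq_swap_of_lt (by simp [Fin.lt_def]; omega)
      (by simp [Fin.lt_def]; omega) he
    simp only [Fin.mk.injEq] at h1 h2
    obtain rfl : a = a' := h1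
    obtain rfl : d = d' := by omega
    obtain rfl : e = e' := by omega
    rfl
  · intro τ hτ
    simp only [mem_filter, mem_univ, true_and] at hτ
    have key : ∃ x y : Fin (n + 2), x < y ∧ τ = swap x y := by
      obtain ⟨x, y, hxy, rfl⟩ := hτ
      rcases lt_or_gt_of_ne hxy with h | h
      · exact ⟨x, y, h, rfl⟩
      · exact ⟨y, x, h, swap_comm x y⟩
    obtain ⟨x, y, hxy, rfl⟩ := key
    have hxy' : (x : ℕ) < y := hxy
    have hy := y.2
    refine ⟨⟨⟨y - x - 1, n - (y - x - 1)⟩, x⟩, ?_, ?_⟩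
    · simp only [mem_sigma, HasAntidiagonal.mem_antidiagonal, mem_range]
      omega
    · congr 1
      ext
      simp only
      omega
  · rintro ⟨⟨d, e⟩, a⟩ hq
    simp only [mem_sigma, HasAntidiagonal.mem_antidiagonal, mem_range] at hq
    obtain ⟨rfl, ha⟩ := hq
    exact (W_remove_swap d e a (by omega) w).symm

lemma val_finRotate_pow (n r : ℕ) (x : Fin (n + 1)) :
    (((finRotate (n + 1)) ^ r) x : ℕ) = (x + r) % (n + 1) := by
  induction r with
  | zero => simp [Nat.mod_eq_of_lt x.2]
  | succ r ih =>
    rw [pow_succ', Perm.mul_apply, val_finRotate, ih, ← add_assoc]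
    have h0 := Nat.mod_lt (x + r) (Nat.succ_pos n)
    split_ifs with h
    · rw [Nat.add_mod, h]
      rcases Nat.eq_zero_or_pos n with rfl | hn
      · simp
      · rw [Nat.mod_eq_of_lt (show 1 < n + 1 by omega), Nat.mod_self]
    · have h1 : (x + r) % (n + 1) + 1 < n + 1 := by omega
      rw [← Nat.mod_add_mod (x + r) (n + 1) 1, Nat.mod_eq_of_lt h1]

lemma W_finRotate_rotate (k n r : ℕ) (w : Fin (n + 1) → Weight) :
    W k (finRotate (n + 1)) (w ∘ ((finRotate (n + 1)) ^ r : Perm (Fin (n + 1)))) =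
      W k (finRotate (n + 1)) w := by
  rw [← W_permCongr]
  congr 1
  rw [Equiv.permCongr_eq_mul, ← pow_succ, pow_succ', mul_assoc, mul_inv_cancel, mul_one]

/-- Rotation invariance for weights whose first entry can be moved to the end. -/
lemma A_tail (w : ℕ → Weight) (n : ℕ) (h : w (n + 1) = w 0) :
    A (fun i => w (i + 1)) n = A w n := by
  rw [A, A, ← W_finRotate_rotate n n 1 fun i : Fin (n + 1) => w i]
  congr 1
  funext i
  have h1 := val_finRotate n i
  rw [Function.comp_apply, pow_one, h1]
  split_ifs with hi
  · rw [hi, h]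
  · rfl

end Cycle

section Counting

variable {α : Type*} [DecidableEq α]

/-- Number of entries of `F` that move `x`. -/
def tCount {k : ℕ} (F : Fin k → Perm α) (x : α) : ℕ :=
  (univ.filter fun i : Fin k => F i x ≠ x).card

/-- Number of entries of `F` that affect the trajectory of `x`. -/
def mCount {k : ℕ} (F : Fin k → Perm α) (x : α) : ℕ :=
  (univ.filter fun i : Fin k =>
    ((List.ofFn F).take i.val).reverse.prod x ≠
      ((List.ofFn F).take (i.val + 1)).reverse.prod x).card

lemma tCount_cons {k : ℕ} (τ : Perm α) (F : Fin k → Perm α) (x : α) :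
    tCount (Fin.cons τ F) x = if τ x ≠ x then tCount F x + 1 else tCount F x := by
  rw [tCount, Fin.card_filter_univ_succ]
  simp [tCount]

lemma mCount_cons {k : ℕ} (τ : Perm α) (F : Fin k → Perm α) (x : α) :
    mCount (Fin.cons τ F) x =
      if τ x ≠ x then mCount F (τ x) + 1 else mCount F (τ x) := by
  rw [mCount, Fin.card_filter_univ_succ]
  simp [mCount, List.ofFn_succ, eq_comm]

variable [Fintype α]

open Classical in
lemma sum_weight_eq_W (k : ℕ) (c : Perm α) (w : α → Weight) :
    (∑ F : Fin k → Perm α,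
      if (∀ i, (F i).IsSwap) ∧ (List.ofFn F).reverse.prod = c then
        ∏ x, (w x).1 (tCount F x) * (w x).2 (mCount F x) else 0) = W k c w := by
  induction k generalizing c w with
  | zero =>
    rw [W]
    simp [tCount, mCount, eq_comm]
  | succ k ih =>
    rw [W, ← (Fin.consEquiv fun _ : Fin (k + 1) => Perm α).sum_comp, Fintype.sum_prod_type,
      Finset.sum_filter]
    refine Finset.sum_congr rfl fun τ _ => ?_
    by_cases hτ : τ.IsSwap
    · rw [if_pos hτ, ← ih]
      refine Finset.sum_congr rfl fun F _ => ?_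
      have hc : ((∀ i, ((Fin.cons τ F : Fin (k + 1) → Perm α) i).IsSwap) ∧
          (List.ofFn (Fin.cons τ F : Fin (k + 1) → Perm α)).reverse.prod = c) ↔
          ((∀ i, (F i).IsSwap) ∧ (List.ofFn F).reverse.prod = c * τ) := by
        refine and_congr ?_ ?_
        · simp [Fin.forall_fin_succ, hτ]
        · rw [List.ofFn_succ, List.reverse_cons, List.prod_append, List.prod_singleton]
          simp only [Fin.cons_zero, Fin.cons_succ]
          constructor
          · rintro rfl
            rw [mul_assoc, mul_self_of_isSwap hτ, mul_one]
          · intro h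
            rw [h, mul_assoc, mul_self_of_isSwap hτ, mul_one]
      have hp : (∏ x, (w x).1 (tCount (Fin.cons τ F : Fin (k + 1) → Perm α) x) *
            (w x).2 (mCount (Fin.cons τ F : Fin (k + 1) → Perm α) x)) =
          ∏ x, (step τ w x).1 (tCount F x) * (step τ w x).2 (mCount F x) := by
        rw [Finset.prod_mul_distrib, Finset.prod_mul_distrib]
        congr 1
        · refine Finset.prod_congr rfl fun x _ => ?_
          rw [tCount_cons, step]
          split_ifs <;> rfl
        · rw [← Equiv.prod_comp τ fun x => (step τ w x).2 (mCount F x)]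
          refine Finset.prod_congr rfl fun x _ => ?_
          rw [mCount_cons, step, swap_apply_apply_of_isSwap hτ]
          by_cases hx : τ x = x
          · simp [hx]
          · simp [hx, Ne.symm hx, sh]
      change (if (∀ i, ((Fin.cons τ F : Fin (k + 1) → Perm α) i).IsSwap) ∧
          (List.ofFn (Fin.cons τ F : Fin (k + 1) → Perm α)).reverse.prod = c then
        ∏ x, (w x).1 (tCount (Fin.cons τ F : Fin (k + 1) → Perm α) x) *
          (w x).2 (mCount (Fin.cons τ F : Fin (k + 1) → Perm α) x) else 0) = _
      rw [hp]
      exact if_congr hc rfl rfl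
    · rw [if_neg hτ]
      refine Finset.sum_eq_zero fun F _ => if_neg fun h => hτ ?_
      simpa using h.1 0

end Counting

section PowerSeriesClass

open PowerSeries Filter Topology

/-- The span of the series `(X u) ^ k * u ^ j` with `k : ℕ` and `j : ℤ`. -/
noncomputable def treeSpan (u : ℝ⟦X⟧ˣ) : Submodule ℝ ℝ⟦X⟧ :=
  Submodule.span ℝ (Set.range fun p : ℕ × ℤ =>
    (X * (u : ℝ⟦X⟧)) ^ p.1 * ((u ^ p.2 : ℝ⟦X⟧ˣ) : ℝ⟦X⟧))

variable {u : ℝ⟦X⟧ˣ}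

lemma treeSpan_basic (k : ℕ) (j : ℤ) :
    (X * (u : ℝ⟦X⟧)) ^ k * ((u ^ j : ℝ⟦X⟧ˣ) : ℝ⟦X⟧) ∈ treeSpan u :=
  Submodule.subset_span ⟨(k, j), rfl⟩

lemma treeSpan_mul {P Q : ℝ⟦X⟧} (hP : P ∈ treeSpan u) (hQ : Q ∈ treeSpan u) :
    P * Q ∈ treeSpan u := by
  have h := Submodule.mul_mem_mul hP hQ
  rw [treeSpan, Submodule.span_mul_span] at h
  refine Submodule.span_mono ?_ h
  rintro _ ⟨_, ⟨⟨k, j⟩, rfl⟩, _, ⟨⟨k', j'⟩, rfl⟩, rfl⟩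
  refine ⟨(k + k', j + j'), ?_⟩
  simp only [pow_add, zpow_add, Units.val_mul]
  ring

lemma treeSpan_zpow (j : ℤ) : ((u ^ j : ℝ⟦X⟧ˣ) : ℝ⟦X⟧) ∈ treeSpan u := by
  simpa using treeSpan_basic (u := u) 0 j

lemma treeSpan_self : (u : ℝ⟦X⟧) ∈ treeSpan u := by
  simpa using treeSpan_zpow (u := u) 1

lemma treeSpan_one : (1 : ℝ⟦X⟧) ∈ treeSpan u := by
  simpa using treeSpan_zpow (u := u) 0

lemma treeSpan_X : (X : ℝ⟦X⟧) ∈ treeSpan u := by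
  have h := treeSpan_basic (u := u) 1 (-1)
  rwa [pow_one, zpow_neg_one, mul_assoc, Units.mul_inv, mul_one] at h

lemma treeSpan_X_pow (n : ℕ) : (X ^ n : ℝ⟦X⟧) ∈ treeSpan u := by
  induction n with
  | zero => simpa using treeSpan_one
  | succ n ih => rw [pow_succ]; exact treeSpan_mul ih treeSpan_X

lemma treeSpan_of_coeff_eq_zero {H : ℝ⟦X⟧} (N : ℕ) (h : ∀ n, N ≤ n → coeff n H = 0) :
    H ∈ treeSpan u := by
  have : H = ∑ n ∈ range N, coeff n H • (X ^ n : ℝ⟦X⟧) := by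
    ext m
    simp only [map_sum, map_smul, coeff_X_pow, smul_eq_mul, mul_ite, mul_one, mul_zero,
      Finset.sum_ite_eq, Finset.mem_range]
    split_ifs with hm
    · rfl
    · exact h m (not_lt.1 hm)
  rw [this]
  exact Submodule.sum_mem _ fun n _ => Submodule.smul_mem _ _ (treeSpan_X_pow n)

lemma treeSpan_of_eventually {H H' : ℝ⟦X⟧} (N : ℕ) (h : ∀ n, N ≤ n → coeff n H = coeff n H')
    (hH' : H' ∈ treeSpan u) : H ∈ treeSpan u := by
  have h1 : H - H' ∈ treeSpan u :=
    treeSpan_of_coeff_eq_zero N fun n hn => by rw [map_sub, h n hn, sub_self]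
  simpa using Submodule.add_mem _ h1 hH'

/-- The series obtained by deleting the coefficients of index less than `p`. -/
noncomputable def tr (p : ℕ) (H : ℝ⟦X⟧) : ℝ⟦X⟧ :=
  PowerSeries.mk fun n => if p ≤ n then coeff n H else 0

@[simp]
lemma coeff_tr (p n : ℕ) (H : ℝ⟦X⟧) : coeff n (tr p H) = if p ≤ n then coeff n H else 0 :=
  coeff_mk _ _

lemma treeSpan_tr (p : ℕ) {H : ℝ⟦X⟧} (h : H ∈ treeSpan u) : tr p H ∈ treeSpan u :=
  treeSpan_of_eventually p (fun n hn => by simp [hn]) h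

lemma derivative_zpow (hu : derivative ℝ (u : ℝ⟦X⟧) = u * derivative ℝ (X * (u : ℝ⟦X⟧))) (j : ℤ) :
    derivative ℝ ((u ^ j : ℝ⟦X⟧ˣ) : ℝ⟦X⟧) =
      (j : ℝ) • (((u ^ j : ℝ⟦X⟧ˣ) : ℝ⟦X⟧) * derivative ℝ (X * (u : ℝ⟦X⟧))) := by
  have hinv : derivative ℝ ((u⁻¹ : ℝ⟦X⟧ˣ) : ℝ⟦X⟧) =
      -(((u⁻¹ : ℝ⟦X⟧ˣ) : ℝ⟦X⟧) * derivative ℝ (X * (u : ℝ⟦X⟧))) := by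
    have h := (derivative ℝ).leibniz_of_mul_eq_one (Units.inv_mul u)
    rw [hu, smul_eq_mul] at h
    rw [h]
    have h2 := Units.inv_mul u
    linear_combination (-((u⁻¹ : ℝ⟦X⟧ˣ) : ℝ⟦X⟧) * derivative ℝ (X * (u : ℝ⟦X⟧))) * h2
  induction j using Int.induction_on with
  | zero => simp
  | succ i ih =>
    rw [zpow_add, zpow_one, Units.val_mul, Derivation.leibniz, ih, hu]
    simp only [smul_eq_mul, PowerSeries.smul_eq_C_mul]
    push_cast
    simp only [map_add, map_one]
    ring
  | pred i ih =>
    rw [zpow_sub, zpow_one, ← div_eq_mul_inv, div_eq_mul_inv, Units.val_mul, Derivation.leibniz,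
      ih, hinv]
    simp only [smul_eq_mul, PowerSeries.smul_eq_C_mul]
    push_cast
    simp only [map_sub, map_one, map_neg]
    ring

lemma exists_integral (hu : derivative ℝ (u : ℝ⟦X⟧) = u * derivative ℝ (X * (u : ℝ⟦X⟧)))
    {R : ℝ⟦X⟧} (hR : R ∈ treeSpan u) :
    ∃ S ∈ treeSpan u, derivative ℝ S = derivative ℝ (X * (u : ℝ⟦X⟧)) * R := by
  induction hR using Submodule.span_induction with
  | zero => exact ⟨0, Submodule.zero_mem _, by simp⟩
  | add P Q _ _ hP hQ =>
    obtain ⟨S, hS, hS'⟩ := hP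
    obtain ⟨S₂, hS₂, hS₂'⟩ := hQ
    exact ⟨S + S₂, Submodule.add_mem _ hS hS₂, by rw [map_add, hS', hS₂', mul_add]⟩
  | smul c P _ hP =>
    obtain ⟨S, hS, hS'⟩ := hP
    exact ⟨c • S, Submodule.smul_mem _ c hS, by rw [Derivation.map_smul, hS', mul_smul_comm]⟩
  | mem x hx =>
    obtain ⟨⟨k, j⟩, rfl⟩ := hx
    simp only
    rcases eq_or_ne j 0 with rfl | hj
    · refine ⟨((k + 1 : ℝ)⁻¹) • ((X * (u : ℝ⟦X⟧)) ^ (k + 1) * ((u ^ (0 : ℤ) : ℝ⟦X⟧ˣ) : ℝ⟦X⟧)),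
        Submodule.smul_mem _ _ (treeSpan_basic _ _), ?_⟩
      have hk : (k + 1 : ℝ) ≠ 0 := by positivity
      have hC : (C (k + 1 : ℝ)⁻¹ : ℝ⟦X⟧) * (k + 1) = 1 := by
        have : ((k + 1 : ℝ⟦X⟧)) = C (k + 1 : ℝ) := by simp
        rw [this, ← map_mul, inv_mul_cancel₀ hk, map_one]
      rw [zpow_zero, Units.val_one, mul_one, Derivation.map_smul, Derivation.leibniz_pow]
      simp only [smul_eq_mul, PowerSeries.smul_eq_C_mul, nsmul_eq_mul, Nat.add_sub_cancel]
      push_cast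
      linear_combination ((X * (u : ℝ⟦X⟧)) ^ k * derivative ℝ (X * (u : ℝ⟦X⟧))) * hC
    · have hj' : (j : ℝ) ≠ 0 := by exact_mod_cast hj
      have hC : (C (j : ℝ)⁻¹ : ℝ⟦X⟧) * C (j : ℝ) = 1 := by
        rw [← map_mul, inv_mul_cancel₀ hj', map_one]
      induction k with
      | zero =>
        refine ⟨((j : ℝ)⁻¹) • ((u ^ j : ℝ⟦X⟧ˣ) : ℝ⟦X⟧),
          Submodule.smul_mem _ _ (treeSpan_zpow _), ?_⟩
        rw [Derivation.map_smul, derivative_zpow hu, smul_smul, inv_mul_cancel₀ hj', one_smul]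
        ring
      | succ k ih =>
        obtain ⟨S, hS, hS'⟩ := ih
        refine ⟨(j : ℝ)⁻¹ • ((X * (u : ℝ⟦X⟧)) ^ (k + 1) * ((u ^ j : ℝ⟦X⟧ˣ) : ℝ⟦X⟧) -
            ((k + 1 : ℕ) : ℝ) • S),
          Submodule.smul_mem _ _ (Submodule.sub_mem _ (treeSpan_basic _ _)
            (Submodule.smul_mem _ _ hS)), ?_⟩
        rw [Derivation.map_smul, map_sub, Derivation.map_smul, hS', Derivation.leibniz,
          derivative_zpow hu, Derivation.leibniz_pow]
        simp only [smul_eq_mul, PowerSeries.smul_eq_C_mul, nsmul_eq_mul, Nat.add_sub_cancel,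
          map_natCast]
        linear_combination ((X * (u : ℝ⟦X⟧)) ^ (k + 1) * ((u ^ j : ℝ⟦X⟧ˣ) : ℝ⟦X⟧) *
          derivative ℝ (X * (u : ℝ⟦X⟧))) * hC

/-- The class is stable under solving the linear differential equation of the recursion. -/
lemma treeSpan_of_equation (hu : derivative ℝ (u : ℝ⟦X⟧) = u * derivative ℝ (X * (u : ℝ⟦X⟧)))
    (j : ℤ) {H R : ℝ⟦X⟧} (hR : R ∈ treeSpan u)
    (h : (1 - X * (u : ℝ⟦X⟧)) * derivative ℝ H + (j : ℝ) • ((u : ℝ⟦X⟧) * H) = R) :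
    H ∈ treeSpan u := by
  obtain ⟨S, hS, hS'⟩ := exists_integral hu (treeSpan_mul hR (treeSpan_zpow (j - 1)))
  have hT : (1 - X * (u : ℝ⟦X⟧)) * derivative ℝ (X * (u : ℝ⟦X⟧)) = (u : ℝ⟦X⟧) := by
    have h1 : derivative ℝ (X * (u : ℝ⟦X⟧)) =
        (u : ℝ⟦X⟧) + X * ((u : ℝ⟦X⟧) * derivative ℝ (X * (u : ℝ⟦X⟧))) := by
      rw [← hu, Derivation.leibniz, derivative_X]
      simp only [smul_eq_mul]
      ring
    linear_combination h1
  have hd : derivative ℝ (((u ^ j : ℝ⟦X⟧ˣ) : ℝ⟦X⟧) * H) = derivative ℝ S := by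
    have hj : ((u ^ j : ℝ⟦X⟧ˣ) : ℝ⟦X⟧) = ((u ^ (j - 1) : ℝ⟦X⟧ˣ) : ℝ⟦X⟧) * (u : ℝ⟦X⟧) := by
      rw [← Units.val_mul, ← zpow_add_one, sub_add_cancel]
    rw [hS', Derivation.leibniz, derivative_zpow hu, ← h]
    simp only [smul_eq_mul, PowerSeries.smul_eq_C_mul]
    rw [hj]
    linear_combination (-((u ^ (j - 1) : ℝ⟦X⟧ˣ) : ℝ⟦X⟧) * derivative ℝ H) * hT
  have hC : ((u ^ j : ℝ⟦X⟧ˣ) : ℝ⟦X⟧) * H ∈ treeSpan u := by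
    refine treeSpan_of_eventually 1 (fun n hn => ?_) hS
    obtain ⟨n, rfl⟩ := Nat.exists_eq_add_of_le' hn
    have h1 := congrArg (coeff n) hd
    rw [coeff_derivative, coeff_derivative] at h1
    exact mul_right_cancel₀ (by positivity) h1
  have h2 := treeSpan_mul (treeSpan_zpow (u := u) (-j)) hC
  rwa [← mul_assoc, ← Units.val_mul, ← zpow_add, neg_add_cancel, zpow_zero, Units.val_one,
    one_mul] at h2

end PowerSeriesClass

section Asymptotics

open PowerSeries Filter Topology

variable {u : ℝ⟦X⟧ˣ}

/-- The coefficients of `H` have a limit relative to those of `u`. -/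
def HasRatio (u : ℝ⟦X⟧ˣ) (H : ℝ⟦X⟧) : Prop :=
  ∃ L : ℝ, Tendsto (fun n => coeff n H / coeff n (u : ℝ⟦X⟧)) atTop (𝓝 L)

lemma coeff_X_mul_derivative (n : ℕ) (H : ℝ⟦X⟧) :
    coeff n (X * derivative ℝ H) = n * coeff n H := by
  cases n with
  | zero => simp
  | succ n =>
    rw [coeff_succ_X_mul, coeff_derivative]
    push_cast
    ring

lemma derivative_X_mul (H : ℝ⟦X⟧) : derivative ℝ (X * H) = H + X * derivative ℝ H := by
  rw [Derivation.leibniz, derivative_X, smul_eq_mul, smul_eq_mul]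
  ring

lemma coeff_zpow_succ
    (hu : derivative ℝ (u : ℝ⟦X⟧) = u * derivative ℝ (X * (u : ℝ⟦X⟧)))
    (j : ℤ) (n : ℕ) :
    (j + 1 : ℝ) * (n + 1) * coeff (n + 1) ((u ^ j : ℝ⟦X⟧ˣ) : ℝ⟦X⟧) =
      j * (j + 1 + n) * coeff n ((u ^ (j + 1) : ℝ⟦X⟧ˣ) : ℝ⟦X⟧) := by
  have h0 := derivative_zpow hu j
  have h1 := derivative_zpow hu (j + 1)
  have hT := derivative_X_mul (u : ℝ⟦X⟧)
  have hj : ((u ^ (j + 1) : ℝ⟦X⟧ˣ) : ℝ⟦X⟧) = ((u ^ j : ℝ⟦X⟧ˣ) : ℝ⟦X⟧) * (u : ℝ⟦X⟧) := by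
    rw [← Units.val_mul, ← zpow_add_one]
  have h2 : C (j + 1 : ℝ) * derivative ℝ ((u ^ j : ℝ⟦X⟧ˣ) : ℝ⟦X⟧) =
      C (j : ℝ) * (C (j + 1 : ℝ) * ((u ^ (j + 1) : ℝ⟦X⟧ˣ) : ℝ⟦X⟧) +
        X * derivative ℝ ((u ^ (j + 1) : ℝ⟦X⟧ˣ) : ℝ⟦X⟧)) := by
    rw [hu] at hT
    rw [h0, h1, hj]
    simp only [PowerSeries.smul_eq_C_mul]
    push_cast
    linear_combination (C (j : ℝ) * C (j + 1 : ℝ) * ((u ^ j : ℝ⟦X⟧ˣ) : ℝ⟦X⟧)) * hT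
  have h3 := congrArg (coeff n) h2
  rw [coeff_C_mul, coeff_C_mul, map_add, coeff_C_mul, coeff_X_mul_derivative,
    coeff_derivative] at h3
  linear_combination h3

lemma coeff_inv
    (hu : derivative ℝ (u : ℝ⟦X⟧) = u * derivative ℝ (X * (u : ℝ⟦X⟧)))
    (n : ℕ) :
    (n + 2 : ℝ) * coeff (n + 2) ((u ^ (-1 : ℤ) : ℝ⟦X⟧ˣ) : ℝ⟦X⟧) =
      -((n + 1) * coeff n (u : ℝ⟦X⟧)) := by
  have h0 := derivative_zpow hu (-1)
  have hT := derivative_X_mul (u : ℝ⟦X⟧)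
  rw [hu] at hT
  have h2 : derivative ℝ ((u ^ (-1 : ℤ) : ℝ⟦X⟧ˣ) : ℝ⟦X⟧) =
      -(1 + X * derivative ℝ (X * (u : ℝ⟦X⟧))) := by
    rw [h0, zpow_neg_one]
    have h := Units.inv_mul u
    push_cast
    rw [neg_one_smul]
    linear_combination (-((u⁻¹ : ℝ⟦X⟧ˣ) : ℝ⟦X⟧)) * hT -
      (1 + X * derivative ℝ (X * (u : ℝ⟦X⟧))) * h
  have h3 := congrArg (coeff (n + 1)) h2
  rw [coeff_derivative, map_neg, map_add, coeff_succ_X_mul, coeff_derivative, coeff_succ_X_mul,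
    coeff_one, if_neg (Nat.succ_ne_zero n)] at h3
  push_cast at h3
  linear_combination h3

lemma coeff_npow
    (hu : derivative ℝ (u : ℝ⟦X⟧) = u * derivative ℝ (X * (u : ℝ⟦X⟧)))
    (hu0 : constantCoeff (u : ℝ⟦X⟧) = 1)
    (n j : ℕ) :
    coeff (n + 1) ((u ^ j : ℝ⟦X⟧ˣ) : ℝ⟦X⟧) = j * (n + 1 + j : ℝ) ^ n / (n + 1).factorial := by
  induction n generalizing j with
  | zero =>
    have h := coeff_zpow_succ hu j 0
    have h1 : coeff 0 ((u ^ ((j : ℤ) + 1) : ℝ⟦X⟧ˣ) : ℝ⟦X⟧) = 1 := by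
      have : u ^ ((j : ℤ) + 1) = u ^ (j + 1) := by exact_mod_cast zpow_natCast u (j + 1)
      rw [this, Units.val_pow_eq_pow_val, coeff_zero_eq_constantCoeff_apply, map_pow, hu0, one_pow]
    rw [h1, zpow_natCast] at h
    have hj : (j + 1 : ℝ) ≠ 0 := by positivity
    push_cast at h
    simp only [pow_zero, mul_one, zero_add, Nat.factorial_one, Nat.cast_one, div_one]
    apply mul_left_cancel₀ hj
    linear_combination h
  | succ n ih =>
    have h := coeff_zpow_succ hu j (n + 1)
    have h1 := ih (j + 1)
    have : u ^ ((j : ℤ) + 1) = u ^ (j + 1) := by exact_mod_cast zpow_natCast u (j + 1)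
    rw [this, h1, zpow_natCast] at h
    have hj : (j + 1 : ℝ) ≠ 0 := by positivity
    have hn : (n + 1 + 1 : ℝ) ≠ 0 := by positivity
    have hf : ((n + 1).factorial : ℝ) ≠ 0 := by positivity
    rw [Nat.factorial_succ]
    push_cast at h ⊢
    apply mul_left_cancel₀ (mul_ne_zero hj hn)
    rw [h]
    field_simp
    ring

lemma coeff_unit
    (hu : derivative ℝ (u : ℝ⟦X⟧) = u * derivative ℝ (X * (u : ℝ⟦X⟧)))
    (hu0 : constantCoeff (u : ℝ⟦X⟧) = 1)
    (n : ℕ) : coeff n (u : ℝ⟦X⟧) = (n + 1 : ℝ) ^ (n - 1) / n.factorial := by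
  cases n with
  | zero => simp [hu0]
  | succ n =>
    have h := coeff_npow hu hu0 n 1
    rw [pow_one] at h
    rw [h]
    push_cast
    simp

lemma coeff_unit_pos
    (hu : derivative ℝ (u : ℝ⟦X⟧) = u * derivative ℝ (X * (u : ℝ⟦X⟧)))
    (hu0 : constantCoeff (u : ℝ⟦X⟧) = 1)
    (n : ℕ) : 0 < coeff n (u : ℝ⟦X⟧) := by
  rw [coeff_unit hu hu0]
  positivity

lemma tendsto_coeff_succ_div
    (hu : derivative ℝ (u : ℝ⟦X⟧) = u * derivative ℝ (X * (u : ℝ⟦X⟧)))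
    (hu0 : constantCoeff (u : ℝ⟦X⟧) = 1) :
    Tendsto (fun n => coeff (n + 1) (u : ℝ⟦X⟧) / coeff n (u : ℝ⟦X⟧)) atTop (𝓝 (Real.exp 1)) := by
  rw [← tendsto_add_atTop_iff_nat 1]
  have h1 : Tendsto (fun n : ℕ => (1 + (1 : ℝ) / n) ^ n) atTop (𝓝 (Real.exp 1)) :=
    Real.tendsto_one_add_div_pow_exp 1
  have h2 : Tendsto (fun n : ℕ => (1 + (1 : ℝ) / n)) atTop (𝓝 1) := by
    simpa using (tendsto_const_div_atTop_nhds_zero_nat (1 : ℝ)).const_add 1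
  have h3 := (h1.div h2 one_ne_zero).comp (tendsto_add_atTop_nat 2)
  rw [div_one] at h3
  refine h3.congr fun n => ?_
  simp only [Function.comp_apply, Pi.div_apply]
  rw [coeff_unit hu hu0, coeff_unit hu hu0, Nat.factorial_succ (n + 1)]
  have hf : ((n + 1).factorial : ℝ) ≠ 0 := by positivity
  have hn : (n + 2 : ℝ) ≠ 0 := by positivity
  have hn' : (n + 3 : ℝ) ≠ 0 := by positivity
  push_cast
  have h4 : (1 + 1 / (n + 2) : ℝ) = (n + 3) / (n + 2) := by field_simp; ring
  rw [h4, div_pow]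
  have h5 : (n + 1 + 1 + 1 : ℝ) = n + 3 := by ring
  have h6 : (n + 1 + 1 : ℝ) = n + 2 := by ring
  rw [h5, h6]
  field_simp
  ring

lemma HasRatio.shift
    (hu : derivative ℝ (u : ℝ⟦X⟧) = u * derivative ℝ (X * (u : ℝ⟦X⟧)))
    (hu0 : constantCoeff (u : ℝ⟦X⟧) = 1)
    {H : ℝ⟦X⟧} (h : HasRatio u H) :
    ∃ L : ℝ, Tendsto (fun n => coeff (n + 1) H / coeff n (u : ℝ⟦X⟧)) atTop (𝓝 L) := by
  obtain ⟨L, hL⟩ := h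
  refine ⟨_, (((tendsto_add_atTop_iff_nat 1).2 hL).mul
    (tendsto_coeff_succ_div hu hu0)).congr fun n => ?_⟩
  have := (coeff_unit_pos hu hu0 (n + 1)).ne'
  field_simp

lemma hasRatio_of_shift
    (hu : derivative ℝ (u : ℝ⟦X⟧) = u * derivative ℝ (X * (u : ℝ⟦X⟧)))
    (hu0 : constantCoeff (u : ℝ⟦X⟧) = 1)
    {H : ℝ⟦X⟧} {L : ℝ}
    (h : Tendsto (fun n => coeff (n + 1) H / coeff n (u : ℝ⟦X⟧)) atTop (𝓝 L)) :
    HasRatio u H := by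
  refine ⟨_, (tendsto_add_atTop_iff_nat 1).1 ((h.div (tendsto_coeff_succ_div hu hu0)
    (Real.exp_ne_zero 1)).congr fun n => ?_)⟩
  have := (coeff_unit_pos hu hu0 n).ne'
  simp only [Pi.div_apply]
  field_simp

lemma HasRatio.X_mul
    (hu : derivative ℝ (u : ℝ⟦X⟧) = u * derivative ℝ (X * (u : ℝ⟦X⟧)))
    (hu0 : constantCoeff (u : ℝ⟦X⟧) = 1)
    {H : ℝ⟦X⟧} (h : HasRatio u H) : HasRatio u (X * H) := by
  obtain ⟨L, hL⟩ := h
  exact hasRatio_of_shift hu hu0 (L := L) (by simpa only [coeff_succ_X_mul] using hL)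

lemma hasRatio_zpow
    (hu : derivative ℝ (u : ℝ⟦X⟧) = u * derivative ℝ (X * (u : ℝ⟦X⟧)))
    (hu0 : constantCoeff (u : ℝ⟦X⟧) = 1)
    (j : ℤ) : HasRatio u ((u ^ j : ℝ⟦X⟧ˣ) : ℝ⟦X⟧) := by
  have lim (a b : ℝ) : Tendsto (fun n : ℕ => (a + 1 * (n : ℝ)) / (b + 1 * n)) atTop (𝓝 (1 / 1)) :=
    tendsto_add_mul_div_add_mul_atTop_nhds a b 1 one_ne_zero
  have hpos (j : ℕ) : HasRatio u ((u ^ ((j : ℤ) + 1) : ℝ⟦X⟧ˣ) : ℝ⟦X⟧) := by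
    induction j with
    | zero =>
      refine ⟨1, tendsto_const_nhds.congr fun n => ?_⟩
      simp [(coeff_unit_pos hu hu0 n).ne']
    | succ j ih =>
      obtain ⟨L, hL⟩ := ih.shift hu hu0
      refine ⟨_, ((lim 1 (j + 2)).mul (hL.const_mul ((j + 2 : ℝ) / (j + 1)))).congr fun n => ?_⟩
      have h := coeff_zpow_succ hu (j + 1) n
      have h1 : (j + 1 : ℝ) ≠ 0 := by positivity
      have h2 : (j + 2 + 1 * n : ℝ) ≠ 0 := by positivity
      have h3 := (coeff_unit_pos hu hu0 n).ne'
      push_cast at h ⊢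
      field_simp
      linear_combination h
  have hneg (j : ℕ) : HasRatio u ((u ^ (-(j : ℤ) - 1) : ℝ⟦X⟧ˣ) : ℝ⟦X⟧) := by
    induction j with
    | zero =>
      obtain ⟨M, hM⟩ : HasRatio u (X * (u : ℝ⟦X⟧)) :=
        HasRatio.X_mul hu hu0 (by simpa using hpos 0)
      refine hasRatio_of_shift hu hu0 (L := -(1 / 1 * M))
        ((tendsto_add_atTop_iff_nat 1).1
        (((lim 1 2).mul ((tendsto_add_atTop_iff_nat 1).2 hM)).neg.congr fun n => ?_))
      have h := coeff_inv hu n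
      have h2 : (2 + 1 * n : ℝ) ≠ 0 := by positivity
      have h3 := (coeff_unit_pos hu hu0 (n + 1)).ne'
      rw [coeff_succ_X_mul]
      simp only [Nat.cast_zero, neg_zero, zero_sub]
      field_simp
      linear_combination -h
    | succ j ih =>
      obtain ⟨L, hL⟩ := ih
      refine hasRatio_of_shift hu hu0 (L := 1 / 1 * ((j + 2 : ℝ) / (j + 1) * L))
        (((lim (-(j + 1)) 1).mul (hL.const_mul ((j + 2 : ℝ) / (j + 1)))).congr fun n => ?_)
      have h := coeff_zpow_succ hu (-((j + 1 : ℕ) : ℤ) - 1) n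
      have h1 : (j + 1 : ℝ) ≠ 0 := by positivity
      have h2 : (1 + 1 * n : ℝ) ≠ 0 := by positivity
      have h3 := (coeff_unit_pos hu hu0 n).ne'
      have h4 : (-((j + 1 : ℕ) : ℤ) - 1 + 1) = -(j : ℤ) - 1 := by push_cast; ring
      rw [h4] at h
      push_cast at h ⊢
      field_simp
      linear_combination h
  rcases lt_trichotomy j 0 with hj | rfl | hj
  · have := hneg (-j - 1).toNat
    rwa [show -(((-j - 1).toNat : ℕ) : ℤ) - 1 = j by omega] at this
  · refine ⟨0, tendsto_const_nhds.congr' ?_⟩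
    filter_upwards [eventually_gt_atTop 0] with n hn
    simp [coeff_one, hn.ne']
  · have := hpos (j - 1).toNat
    rwa [show (((j - 1).toNat : ℕ) : ℤ) + 1 = j by omega] at this

lemma hasRatio_of_mem_treeSpan
    (hu : derivative ℝ (u : ℝ⟦X⟧) = u * derivative ℝ (X * (u : ℝ⟦X⟧)))
    (hu0 : constantCoeff (u : ℝ⟦X⟧) = 1)
    {H : ℝ⟦X⟧} (h : H ∈ treeSpan u) : HasRatio u H := by
  induction h using Submodule.span_induction with
  | zero => exact ⟨0, by simp⟩
  | add P Q _ _ hP hQ =>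
    obtain ⟨L, hL⟩ := hP
    obtain ⟨M, hM⟩ := hQ
    exact ⟨L + M, (hL.add hM).congr fun n => by rw [map_add, add_div]⟩
  | smul c P _ hP =>
    obtain ⟨L, hL⟩ := hP
    exact ⟨c * L, (hL.const_mul c).congr fun n => by
      rw [coeff_smul, smul_eq_mul, mul_div_assoc]⟩
  | mem x hx =>
    obtain ⟨⟨k, j⟩, rfl⟩ := hx
    have h (k : ℕ) (j : ℤ) : HasRatio u (X ^ k * ((u ^ j : ℝ⟦X⟧ˣ) : ℝ⟦X⟧)) := by
      induction k with
      | zero => simpa using hasRatio_zpow hu hu0 j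
      | succ k ih => rw [pow_succ', mul_assoc]; exact ih.X_mul hu hu0
    have h1 := h k (k + j)
    rw [zpow_add, zpow_natCast, Units.val_mul, Units.val_pow_eq_pow_val, ← mul_assoc,
      ← mul_pow] at h1
    exact h1

end Asymptotics

section GeneratingSeries

open PowerSeries

/-- Exponential generating series of the weighted minimal factorizations. -/
noncomputable def gser (w : ℕ → Weight) : ℝ⟦X⟧ := PowerSeries.mk fun n => A w n / n.factorial

lemma coeff_gser_succ (w : ℕ → Weight) (n : ℕ) :
    coeff n (derivative ℝ (gser w)) = ∑ p ∈ antidiagonal n, ∑ a ∈ range (p.2 + 1),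
      coeff p.1 (gser (inner w a (a + 1 + p.1))) * coeff p.2 (gser (outer w a (a + 1 + p.1))) := by
  rw [coeff_derivative, gser, coeff_mk, A_succ, Finset.sum_div, Finset.sum_mul]
  refine Finset.sum_congr rfl fun p hp => ?_
  rw [Finset.sum_div, Finset.sum_mul]
  refine Finset.sum_congr rfl fun a _ => ?_
  rw [gser, gser, coeff_mk, coeff_mk, Nat.factorial_succ]
  have hp' := Finset.HasAntidiagonal.mem_antidiagonal.1 hp
  have h : (n.choose p.1 : ℝ) * p.1.factorial * p.2.factorial = n.factorial := by
    rw [← hp']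
    rw [Nat.choose_symm_add]
    exact_mod_cast Nat.add_choose_mul_factorial_mul_factorial p.1 p.2
  have h1 : (p.1.factorial : ℝ) ≠ 0 := by positivity
  have h2 : (p.2.factorial : ℝ) ≠ 0 := by positivity
  have h3 : (n.factorial : ℝ) ≠ 0 := by positivity
  have h4 : (n + 1 : ℝ) ≠ 0 := by positivity
  push_cast
  field_simp
  rw [← h]
  ring

lemma inner_of_le {w : ℕ → Weight} {N a b : ℕ} (hw : ∀ i, N ≤ i → w i = 1) (hb : N ≤ b) :
    inner w a b = inner w a N := by
  funext i
  cases i with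
  | zero => rw [inner, inner, hw b hb, hw N le_rfl]
  | succ i => rfl

lemma outer_of_le {w : ℕ → Weight} {N a b : ℕ} (hw : ∀ i, N ≤ i → w i = 1) (ha : a < N)
    (hb : N ≤ b) : outer w a b = outer w a N := by
  funext i
  rw [outer, outer, hw b hb, hw N le_rfl]
  split_ifs with h1 h2
  · rfl
  · rfl
  · rw [hw _ (by omega), hw _ (by omega)]

lemma inner_eq_one {w : ℕ → Weight} {N a b : ℕ} (hw : ∀ i, N ≤ i → w i = 1) (ha : N ≤ a)
    (hab : a < b) : inner w a b = 1 := by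
  funext i
  cases i with
  | zero => rw [inner, hw a ha, hw b (by omega)]; rfl
  | succ i => rw [inner, hw _ (by omega)]; rfl

lemma outer_eq_self {w : ℕ → Weight} {N a b : ℕ} (hw : ∀ i, N ≤ i → w i = 1) (ha : N ≤ a)
    (hab : a < b) : outer w a b = w := by
  funext i
  rw [outer, hw a ha, hw b (by omega)]
  split_ifs with h1 h2
  · rfl
  · rw [h2, hw a ha]; rfl
  · rw [hw _ (by omega), hw _ (by omega)]

lemma derivative_gser {w : ℕ → Weight} {N : ℕ} (hw : ∀ i, N ≤ i → w i = 1) :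
    derivative ℝ (gser w) =
      ∑ a ∈ range N, (tr (N - 1 - a) (gser (inner w a N)) * tr a (gser (outer w a N)) +
        ∑ d ∈ range (N - 1 - a), monomial d (coeff d (gser (inner w a (a + 1 + d)))) *
          tr a (gser (outer w a (a + 1 + d)))) +
      gser 1 * PowerSeries.mk fun e => ((e + 1 - N : ℕ) : ℝ) * coeff e (gser w) := by
  ext n
  rw [coeff_gser_succ, map_add, map_sum, coeff_mul]
  have h1 : ∀ a ∈ range N, coeff n (tr (N - 1 - a) (gser (inner w a N)) *
        tr a (gser (outer w a N)) +
        ∑ d ∈ range (N - 1 - a), monomial d (coeff d (gser (inner w a (a + 1 + d)))) *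
          tr a (gser (outer w a (a + 1 + d)))) =
      ∑ p ∈ antidiagonal n, if a ≤ p.2 then coeff p.1 (gser (inner w a (a + 1 + p.1))) *
        coeff p.2 (gser (outer w a (a + 1 + p.1))) else 0 := by
    intro a ha
    have ha := Finset.mem_range.1 ha
    rw [map_add, map_sum, coeff_mul]
    simp_rw [coeff_mul]
    rw [Finset.sum_comm, ← Finset.sum_add_distrib]
    refine Finset.sum_congr rfl fun p _ => ?_
    simp only [coeff_tr, coeff_monomial, ite_mul, zero_mul, Finset.sum_ite_eq, Finset.mem_range]
    by_cases h2 : a ≤ p.2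
    · simp only [h2, if_true]
      by_cases h3 : N - 1 - a ≤ p.1
      · rw [if_pos h3, if_neg (not_lt.2 h3), inner_of_le hw (b := a + 1 + p.1) (by omega),
          outer_of_le hw ha (b := a + 1 + p.1) (by omega), add_zero]
      · rw [if_neg h3, if_pos (not_le.1 h3), zero_add]
    · simp [h2]
  rw [Finset.sum_congr rfl h1, Finset.sum_comm, ← Finset.sum_add_distrib]
  refine Finset.sum_congr rfl fun p _ => ?_
  rw [coeff_mk, ← Finset.sum_filter]
  have h2 : range (p.2 + 1) = (range N).filter (fun a => a ≤ p.2) ∪ Finset.Ico N (p.2 + 1) := by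
    ext a
    simp only [Finset.mem_range, Finset.mem_union, Finset.mem_filter, Finset.mem_Ico]
    omega
  rw [h2, Finset.sum_union]
  · congr 1
    rw [Finset.sum_congr rfl (g := fun _ => coeff p.1 (gser 1) * coeff p.2 (gser w)),
      Finset.sum_const, Nat.card_Ico, nsmul_eq_mul]
    · ring
    · intro a ha
      have ha := (Finset.mem_Ico.1 ha).1
      rw [inner_eq_one hw ha (by omega), outer_eq_self hw ha (by omega)]
  · rw [Finset.disjoint_left]
    intro a ha
    simp only [Finset.mem_range, Finset.mem_filter, Finset.mem_Ico] at ha ⊢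
    omega

lemma constantCoeff_gser_one : constantCoeff (gser 1) = 1 := by
  rw [← coeff_zero_eq_constantCoeff_apply, gser, coeff_mk, A, W,
    if_pos (Equiv.ext fun _ => Subsingleton.elim (α := Fin 1) _ _)]
  simp

/-- The generating series of minimal factorizations, as a unit. -/
noncomputable def treeUnit : ℝ⟦X⟧ˣ :=
  (PowerSeries.isUnit_iff_constantCoeff.2 (by rw [constantCoeff_gser_one]; exact isUnit_one) :
    IsUnit (gser 1)).unit

lemma val_treeUnit : (treeUnit : ℝ⟦X⟧) = gser 1 := IsUnit.unit_spec _

lemma constantCoeff_treeUnit : constantCoeff (treeUnit : ℝ⟦X⟧) = 1 := by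
  rw [val_treeUnit, constantCoeff_gser_one]

lemma derivative_treeUnit :
    derivative ℝ (treeUnit : ℝ⟦X⟧) = treeUnit * derivative ℝ (X * (treeUnit : ℝ⟦X⟧)) := by
  rw [val_treeUnit, derivative_gser (w := 1) (N := 0) fun _ _ => rfl, Finset.range_zero,
    Finset.sum_empty, zero_add]
  congr 1
  ext n
  rw [coeff_mk, coeff_derivative, coeff_succ_X_mul]
  push_cast
  ring

lemma gser_mem_of_reductions {w : ℕ → Weight} {N : ℕ} (hw : ∀ i, N ≤ i → w i = 1)
    (hi : ∀ a, a < N → gser (inner w a N) ∈ treeSpan treeUnit)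
    (ho : ∀ a b, a < b → b ≤ N → gser (outer w a b) ∈ treeSpan treeUnit) :
    gser w ∈ treeSpan treeUnit := by
  have hlow : derivative ℝ (tr N (gser w)) - derivative ℝ (gser w) ∈ treeSpan treeUnit := by
    refine treeSpan_of_coeff_eq_zero N fun n hn => ?_
    rw [map_sub, coeff_derivative, coeff_derivative, coeff_tr, if_pos (by omega), sub_self]
  have hmk : (PowerSeries.mk fun e => ((e + 1 - N : ℕ) : ℝ) * coeff e (gser w)) =
      X * derivative ℝ (tr N (gser w)) - ((N : ℤ) - 1 : ℤ) • tr N (gser w) := by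
    ext n
    rw [coeff_mk, map_sub, coeff_X_mul_derivative, map_zsmul, coeff_tr, zsmul_eq_mul]
    split_ifs with h
    · rw [Nat.cast_sub (by omega)]
      push_cast
      ring
    · rw [show n + 1 - N = 0 by omega]
      simp
  have hsum : ∑ a ∈ range N, (tr (N - 1 - a) (gser (inner w a N)) * tr a (gser (outer w a N)) +
        ∑ d ∈ range (N - 1 - a), monomial d (coeff d (gser (inner w a (a + 1 + d)))) *
          tr a (gser (outer w a (a + 1 + d)))) ∈ treeSpan treeUnit := by
    refine Submodule.sum_mem _ fun a ha => ?_
    have ha := Finset.mem_range.1 ha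
    refine Submodule.add_mem _
      (treeSpan_mul (treeSpan_tr _ (hi a ha)) (treeSpan_tr _ (ho a N ha le_rfl)))
      (Submodule.sum_mem _ fun d hd => ?_)
    have hd := Finset.mem_range.1 hd
    refine treeSpan_mul ?_ (treeSpan_tr _ (ho a _ (by omega) (by omega)))
    refine treeSpan_of_coeff_eq_zero (d + 1) fun n hn => ?_
    rw [coeff_monomial, if_neg (by omega)]
  refine treeSpan_of_eventually N (H' := tr N (gser w)) (fun n hn => by simp [hn]) ?_
  refine treeSpan_of_equation derivative_treeUnit ((N : ℤ) - 1)
    (Submodule.add_mem _ hsum hlow) ?_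
  have h := derivative_gser hw
  rw [hmk] at h
  rw [h, val_treeUnit, zsmul_eq_mul, PowerSeries.smul_eq_C_mul, map_intCast]
  ring

end GeneratingSeries

section Window

open PowerSeries

/-- A weight function that is constant equal to one or finitely supported. -/
def IsFin (α : ℕ → ℝ) : Prop := α = 1 ∨ ∃ m, ∀ k, m ≤ k → α k = 0

lemma IsFin.sh {α : ℕ → ℝ} (h : IsFin α) : IsFin (sh α) := by
  rcases h with rfl | ⟨m, hm⟩
  · exact Or.inl rfl
  · exact Or.inr ⟨m, fun k hk => hm _ (by omega)⟩

open Classical in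
/-- Complexity of a weight function; it decreases under shifts. -/
noncomputable def sz (α : ℕ → ℝ) : ℕ :=
  if α = 1 then 0 else sInf {s | ∀ k, s ≤ k → α k = 0} + 1

lemma sz_one : sz 1 = 0 := if_pos rfl

lemma sz_pos {α : ℕ → ℝ} (h : α ≠ 1) : 0 < sz α := by
  rw [sz, if_neg h]
  omega

lemma sz_sh_le {α : ℕ → ℝ} (hα : IsFin α) :
    sz (sh α) ≤ sz α ∧ (α ≠ 1 → α ≠ 0 → sz (sh α) < sz α) := by
  by_cases h1 : α = 1
  · subst h1
    exact ⟨le_rfl, fun h => absurd rfl h⟩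
  have hm : ∀ k, sInf {s | ∀ k, s ≤ k → α k = 0} ≤ k → α k = 0 :=
    Nat.sInf_mem (s := {s | ∀ k, s ≤ k → α k = 0}) (hα.resolve_left h1)
  rw [sz, sz, if_neg h1]
  generalize sInf {s | ∀ k, s ≤ k → α k = 0} = m at hm ⊢
  have h2 : sInf {s | ∀ k, s ≤ k → sh α k = 0} ≤ m - 1 :=
    Nat.sInf_le fun k hk => hm (k + 1) (by omega)
  have h3 : α ≠ 0 → 0 < m := by
    intro h
    by_contra h4
    exact h (funext fun k => hm k (by omega))
  split_ifs
  · exact ⟨by omega, fun _ _ => by omega⟩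
  · exact ⟨by omega, fun _ h => by have := h3 h; omega⟩

/-- Complexity of a pair of weight functions. -/
noncomputable def wsz (x : Weight) : ℕ := sz x.1 + sz x.2

lemma sz_add_lt {x : Weight} (h1 : IsFin x.1) (h2 : IsFin x.2) (hx : x ≠ 1)
    (h0 : ¬ (x.1 = 0 ∨ x.2 = 0)) : sz (sh x.1) < wsz x ∧ sz (sh x.2) < wsz x := by
  rw [not_or] at h0
  have a1 := sz_sh_le h1
  have a2 := sz_sh_le h2
  by_cases hx1 : x.1 = 1
  · have hx2 : x.2 ≠ 1 := fun h => hx (Prod.ext hx1 h)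
    have := a2.2 hx2 h0.2
    have := sz_pos hx2
    rw [wsz]
    omega
  · have := a1.2 hx1 h0.1
    have := sz_pos hx1
    rw [wsz]
    omega

theorem gser_mem_treeSpan {w : ℕ → Weight} {N : ℕ} (hw : ∀ i, N ≤ i → w i = 1)
    (hfin : ∀ i, IsFin (w i).1 ∧ IsFin (w i).2) : gser w ∈ treeSpan treeUnit := by
  obtain ⟨μ, hμ⟩ : ∃ μ, μ = N + ∑ i ∈ range N, wsz (w i) := ⟨_, rfl⟩
  induction μ using Nat.strong_induction_on generalizing w N with
  | _ μ ih =>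
  have hone : w N = 1 := hw N le_rfl
  have hinner (a b : ℕ) (i : ℕ) : IsFin (inner w a b i).1 ∧ IsFin (inner w a b i).2 := by
    cases i with
    | zero => exact ⟨(hfin b).1.sh, (hfin a).2.sh⟩
    | succ i => exact hfin _
  have houter (a b : ℕ) (i : ℕ) : IsFin (outer w a b i).1 ∧ IsFin (outer w a b i).2 := by
    rw [outer]
    split_ifs
    · exact hfin _
    · exact ⟨(hfin a).1.sh, (hfin b).2.sh⟩
    · exact hfin _
  by_cases hzero : ∃ i, (w i).1 = 0 ∨ (w i).2 = 0
  · obtain ⟨i, hi⟩ := hzero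
    refine treeSpan_of_coeff_eq_zero i fun n hn => ?_
    rw [gser, coeff_mk, A, W_eq_zero_of_weight_eq_zero (x := ⟨i, by omega⟩) hi, zero_div]
  rw [not_exists] at hzero
  rcases N with _ | N
  · have : w = 1 := funext fun i => hw i (Nat.zero_le i)
    rw [this, ← val_treeUnit]
    exact treeSpan_self
  by_cases hfirst : w 0 = 1
  · refine treeSpan_of_eventually (H' := gser fun i => w (i + 1)) N (fun n hn => ?_)
      (ih _ ?_ (w := fun i => w (i + 1)) (N := N) (fun i hi => hw _ (by omega))
        (fun i => hfin _) rfl)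
    · rw [gser, gser, coeff_mk, coeff_mk, A_tail]
      rw [hfirst, hw _ (by omega)]
    · rw [hμ, Finset.sum_range_succ']
      omega
  by_cases hlast : w N = 1
  · refine ih _ ?_ (N := N) (fun i hi => ?_) hfin rfl
    · rw [hμ, Finset.sum_range_succ]
      omega
    · rcases hi.lt_or_eq with h | rfl
      · exact hw i h
      · exact hlast
  refine gser_mem_of_reductions hw (fun a ha => ?_) (fun a b hab hb => ?_)
  · refine ih _ ?_ (N := N - a + 1) (fun i hi => ?_) (hinner a (N + 1)) rfl
    · obtain ⟨r, rfl⟩ := Nat.exists_eq_add_of_le (Nat.lt_succ_iff.1 ha)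
      rw [hμ, Finset.sum_range_succ', show a + r - a = r by omega,
        show a + r + 1 = a + 1 + r by omega, Finset.sum_range_add, Finset.sum_range_succ]
      have h0 : wsz (inner w a (a + 1 + r) 0) = sz (sh (w a).2) := by
        rw [inner, wsz, ← show a + r + 1 = a + 1 + r by omega, hone]
        exact (congrArg (· + _) sz_one).trans (zero_add _)
      rw [h0]
      have h1 := (sz_sh_le (hfin a).2).1
      have h2 : ∑ i ∈ range r, wsz (inner w a (a + 1 + r) (i + 1)) =
        ∑ i ∈ range r, wsz (w (a + 1 + i)) := rfl
      rw [h2]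
      rcases Nat.eq_zero_or_pos a with rfl | ha'
      · have := (sz_add_lt (hfin 0).1 (hfin 0).2 hfirst (hzero 0)).2
        omega
      · have h3 : sz (w a).2 ≤ wsz (w a) := Nat.le_add_left _ _
        omega
    · cases i with
      | zero => omega
      | succ i => rw [inner]; exact hw _ (by omega)
  · refine ih _ ?_ (N := a + 1 + (N - b)) (fun i hi => ?_) (houter a b) rfl
    · have hleft : ∑ i ∈ range a, wsz (outer w a b i) = ∑ i ∈ range a, wsz (w i) :=
        Finset.sum_congr rfl fun i hi => by rw [outer, if_pos (Finset.mem_range.1 hi)]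
      have hright : ∑ i ∈ range (N - b), wsz (outer w a b (a + 1 + i)) =
          ∑ i ∈ range (N - b), wsz (w (b + 1 + i)) :=
        Finset.sum_congr rfl fun i hi => by
          rw [outer, if_neg (by omega), if_neg (by omega),
            show a + 1 + i + (b - a) = b + 1 + i by omega]
      have hmid : wsz (outer w a b a) = sz (sh (w a).1) + sz (sh (w b).2) := by
        rw [outer, if_neg (lt_irrefl a), if_pos rfl, wsz]
      have h1 := (sz_sh_le (hfin a).1).1
      have h2 := (sz_sh_le (hfin b).2).1
      have h3 : sz (w a).1 ≤ wsz (w a) := Nat.le_add_right _ _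
      have h4 : sz (w b).2 ≤ wsz (w b) := Nat.le_add_left _ _
      rw [hμ, Finset.sum_range_add, Finset.sum_range_succ, hleft, hright, hmid]
      rcases hb.lt_or_eq with hb' | rfl
      · obtain ⟨c, rfl⟩ := Nat.exists_eq_add_of_lt hab
        obtain ⟨r, rfl⟩ := Nat.exists_eq_add_of_le (Nat.lt_succ_iff.1 hb')
        rw [show a + c + 1 + r + 1 = a + 1 + c + 1 + r by omega, Finset.sum_range_add,
          Finset.sum_range_succ _ (a + 1 + c), Finset.sum_range_add,
          Finset.sum_range_succ, show a + c + 1 + r - (a + c + 1) = r by omega,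
          show a + 1 + c = a + c + 1 by omega]
        omega
      · have h5 : sz (sh (w (N + 1)).2) = 0 := by rw [hone]; exact sz_one
        rw [h5, show N - (N + 1) = 0 by omega, Finset.sum_range_zero]
        obtain ⟨r, rfl⟩ := Nat.exists_eq_add_of_le (Nat.lt_succ_iff.1 hab)
        rw [show a + r + 1 = a + 1 + r by omega, Finset.sum_range_add, Finset.sum_range_succ]
        rcases Nat.eq_zero_or_pos r with rfl | hr
        · have := (sz_add_lt (hfin a).1 (hfin a).2 hlast (hzero a)).1
          omega
        · omega
    · rw [outer, if_neg (by omega), if_neg (by omega)]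
      exact hw _ (by omega)

end Window

section Statistics

open PowerSeries

/-- Indicator of a single value, as a weight function. -/
def ind (s : ℕ) : ℕ → ℝ := fun k => if k = s then 1 else 0

lemma isFin_ind (s : ℕ) : IsFin (ind s) :=
  Or.inr ⟨s + 1, fun k hk => if_neg (by omega)⟩

/-- Weights prescribing the statistics `t` and `m` in a window of size `2 * K + 1`. -/
def windowWeight (K : ℕ) (t m : ℤ → ℕ) (p : ℕ) : Weight :=
  if p < 2 * K + 1 then (ind (t (p - K)), ind (m (p - K))) else 1

lemma gser_windowWeight_mem (K : ℕ) (t m : ℤ → ℕ) :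
    gser (windowWeight K t m) ∈ treeSpan treeUnit := by
  refine gser_mem_treeSpan (N := 2 * K + 1) (fun i hi => if_neg (by omega)) fun i => ?_
  rw [windowWeight]
  split_ifs
  · exact ⟨isFin_ind _, isFin_ind _⟩
  · exact ⟨Or.inl rfl, Or.inl rfl⟩

/-- The prescribed statistics, for positions read modulo the rotation of the window. -/
lemma prod_windowWeight {n K : ℕ} (t m : ℤ → ℕ) (hn : 2 * K ≤ n) (T M : Fin (n + 1) → ℕ)
    (σ : ∀ i : ℤ, -(K : ℤ) ≤ i → i ≤ K → Fin (n + 1))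
    (hσ : ∀ i h1 h2, ((σ i h1 h2 : ℕ) : ℤ) = if 1 ≤ i then i - 1 else (n + 1 : ℤ) + i - 1)
    [Decidable (∀ i h1 h2, T (σ i h1 h2) = t i ∧ M (σ i h1 h2) = m i)] :
    (∏ x, (windowWeight K t m (((finRotate (n + 1)) ^ (K + 1) : Perm (Fin (n + 1))) x)).1 (T x) *
      (windowWeight K t m (((finRotate (n + 1)) ^ (K + 1) : Perm (Fin (n + 1))) x)).2 (M x)) =
      if ∀ i h1 h2, T (σ i h1 h2) = t i ∧ M (σ i h1 h2) = m i then 1 else 0 := by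
  have hmod (x : Fin (n + 1)) : (((finRotate (n + 1)) ^ (K + 1) : Perm (Fin (n + 1))) x : ℕ) =
      if (x : ℕ) + K < n then x + K + 1 else x + K - n := by
    have hx := x.2
    rw [val_finRotate_pow]
    split_ifs with h
    · exact Nat.mod_eq_of_lt (by omega)
    · rw [Nat.mod_eq_sub_mod (by omega), Nat.mod_eq_of_lt (by omega)]
      omega
  split_ifs with h
  · refine Finset.prod_eq_one fun x _ => ?_
    have hx := hmod x
    have hx2 := x.2
    generalize (((finRotate (n + 1)) ^ (K + 1) : Perm (Fin (n + 1))) x : ℕ) = q at hx ⊢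
    rw [windowWeight]
    split_ifs with hq
    · have h1 : σ ((q : ℤ) - K) (by omega) (by omega) = x := by
        have h3 := hσ ((q : ℤ) - K) (by omega) (by omega)
        refine Fin.ext ?_
        split_ifs at hx h3 <;> omega
      have h2 := h ((q : ℤ) - K) (by omega) (by omega)
      rw [h1] at h2
      simp [ind, h2.1, h2.2]
    · simp
  · push Not at h
    obtain ⟨i, h1, h2, h3⟩ := h
    refine Finset.prod_eq_zero (Finset.mem_univ (σ i h1 h2)) ?_
    have hx := hmod (σ i h1 h2)
    have hx2 := (σ i h1 h2).2
    have h4 := hσ i h1 h2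
    have hq : (((finRotate (n + 1)) ^ (K + 1) : Perm (Fin (n + 1))) (σ i h1 h2) : ℕ) =
        (i + K).toNat := by
      split_ifs at hx h4 <;> omega
    rw [hq, windowWeight, if_pos (by omega), show (((i + K).toNat : ℕ) : ℤ) - K = i by omega]
    by_cases h5 : T (σ i h1 h2) = t i
    · simp [ind, h3 h5]
    · simp [ind, h5]

lemma card_eq_A {n K : ℕ} (t m : ℤ → ℕ) (hn : 2 * K ≤ n)
    (σ : ∀ i : ℤ, -(K : ℤ) ≤ i → i ≤ K → Fin (n + 1))
    (hσ : ∀ i h1 h2, ((σ i h1 h2 : ℕ) : ℤ) = if 1 ≤ i then i - 1 else (n + 1 : ℤ) + i - 1) :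
    (Nat.card {F : Fin n → Perm (Fin (n + 1)) //
      ((∀ k, (F k).IsSwap) ∧ (List.ofFn F).reverse.prod = finRotate (n + 1)) ∧
        ∀ i h1 h2, tCount F (σ i h1 h2) = t i ∧ mCount F (σ i h1 h2) = m i} : ℝ) =
      A (windowWeight K t m) n := by
  classical
  rw [A, ← W_finRotate_rotate n n (K + 1), ← sum_weight_eq_W, Nat.card_eq_fintype_card,
    Fintype.card_subtype, Finset.card_filter]
  push_cast
  refine Finset.sum_congr rfl fun F _ => ?_
  rw [ite_and]
  refine if_congr Iff.rfl ?_ rfl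
  exact (prod_windowWeight t m hn (tCount F) (mCount F) σ hσ).symm

end Statistics

end MinFact
end

/-- fix `K ≥ 1` and natural numbers `t i, m i` for integers
`-K ≤ i ≤ K`. For `n > 2K`, let `σ_n i = i` if `1 ≤ i ≤ K` and `σ_n i = n + i` if
`-K ≤ i ≤ 0`. Then the proportion of minimal factorizations of size `n` with
`T_{σ_n i} = t i` and `M_{σ_n i} = m i` for all `-K ≤ i ≤ K` converges to some
`L ≥ 0` as `n → ∞`. The sequence is indexed by `n = mm + 2K + 1 > 2K`; the element
`σ_n i` of `{1,…,n}` is the index `σ_n i - 1 : Fin n`. -/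
theorem limit_local_statistics_exists (K : ℕ) (hK : 1 ≤ K) (t m : ℤ → ℕ) :
    ∃ L : ℝ, 0 ≤ L ∧
      Filter.Tendsto (fun mm : ℕ =>
        (Nat.card {F : Fin ((mm + 2 * K + 1) - 1) → Equiv.Perm (Fin (mm + 2 * K + 1)) //
            IsMinFact (mm + 2 * K + 1) F ∧ ∀ (i : ℤ) (h1 : -(K : ℤ) ≤ i) (h2 : i ≤ K),
              Tcount F ⟨(if 1 ≤ i then i - 1 else (mm + 2 * K + 1 : ℤ) + i - 1).toNat,
                  by split <;> omega⟩ = t i ∧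
              Mcount F ⟨(if 1 ≤ i then i - 1 else (mm + 2 * K + 1 : ℤ) + i - 1).toNat,
                  by split <;> omega⟩ = m i} : ℝ) /
          ((mm + 2 * K + 1 : ℝ) ^ ((mm + 2 * K + 1) - 2)))
        Filter.atTop (nhds L) := by
  obtain ⟨L, hL⟩ := MinFact.hasRatio_of_mem_treeSpan MinFact.derivative_treeUnit
    MinFact.constantCoeff_treeUnit (MinFact.gser_windowWeight_mem K t m)
  have key : Filter.Tendsto (fun mm : ℕ =>
      (Nat.card {F : Fin ((mm + 2 * K + 1) - 1) → Equiv.Perm (Fin (mm + 2 * K + 1)) //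
          IsMinFact (mm + 2 * K + 1) F ∧ ∀ (i : ℤ) (h1 : -(K : ℤ) ≤ i) (h2 : i ≤ K),
            Tcount F ⟨(if 1 ≤ i then i - 1 else (mm + 2 * K + 1 : ℤ) + i - 1).toNat,
                by split <;> omega⟩ = t i ∧
            Mcount F ⟨(if 1 ≤ i then i - 1 else (mm + 2 * K + 1 : ℤ) + i - 1).toNat,
                by split <;> omega⟩ = m i} : ℝ) /
        ((mm + 2 * K + 1 : ℝ) ^ ((mm + 2 * K + 1) - 2)))
      Filter.atTop (nhds L) := by
    refine ((Filter.tendsto_add_atTop_iff_nat (2 * K)).2 hL).congr fun mm => ?_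
    have h := MinFact.card_eq_A (n := mm + 2 * K) (K := K) t m (by omega)
      (fun i h1 h2 => ⟨(if 1 ≤ i then i - 1 else (mm + 2 * K + 1 : ℤ) + i - 1).toNat,
        by split <;> omega⟩)
      (fun i h1 h2 => by push_cast; split_ifs <;> omega)
    rw [MinFact.coeff_unit MinFact.derivative_treeUnit MinFact.constantCoeff_treeUnit,
      MinFact.gser, PowerSeries.coeff_mk, ← h,
      div_div_div_cancel_right₀ (by positivity)]
    push_cast
    rfl
  exact ⟨L, ge_of_tendsto' key fun mm => by positivity, key⟩
end

section
/- Fix an integer m ≥ 1 and real numbers x_1, …, x_m with 0 < x_k < 1 for all k. Then there exists a real number L ≥ 0 such that the sequence n ↦ (number of minimal factorizations F ∈ 𝔐_n such that exactly m of the transpositions τ_1, …, τ_{n-1} move the element 1, and such that, denoting by t_1 < t_2 < ⋯ < t_m the indices k for which τ_k moves 1, one has t_k ≤ x_k · n for all 1 ≤ k ≤ m) / n^{n-2} converges to L as n → ∞. -/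
section Counting

open Equiv Equiv.Perm

theorem sameCycle_swap_mul {V : Type*} [Finite V] [DecidableEq V] {σ : Perm V} {a b : V}
    (hab : ¬ σ.SameCycle a b) :
    (swap a b * σ).SameCycle a b ∧
      ∀ x y, σ.SameCycle x y → (swap a b * σ).SameCycle x y := by
  have aux : ∀ c d : V, ¬ σ.SameCycle c d → ∀ i : ℕ,
      (swap c d * σ).SameCycle c ((σ ^ i) c) := by
    intro c d hcd i
    induction i with
    | zero => exact SameCycle.refl _ _
    | succ i ih =>
      by_cases h : (σ ^ (i + 1)) c = c
      · rw [h]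
      · have hd : (σ ^ (i + 1)) c ≠ d := fun h' => hcd ⟨(i + 1 : ℕ), by rw [zpow_natCast, h']⟩
        refine ih.trans ⟨1, ?_⟩
        rw [pow_succ', Perm.mul_apply] at h hd ⊢
        simp [swap_apply_of_ne_of_ne h hd]
  have auxa : ∀ x, σ.SameCycle a x → (swap a b * σ).SameCycle a x := by
    intro x hx
    obtain ⟨i, rfl⟩ := hx.exists_nat_pow_eq
    exact aux a b hab i
  have auxb : ∀ x, σ.SameCycle b x → (swap a b * σ).SameCycle b x := by
    intro x hx
    obtain ⟨i, rfl⟩ := hx.exists_nat_pow_eq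
    rw [swap_comm]
    exact aux b a (fun h => hab h.symm) i
  have key : (swap a b * σ).SameCycle a b := by
    refine (auxa (σ⁻¹ a) ⟨-1, by simp⟩).trans ⟨1, by simp⟩
  refine ⟨key, ?_⟩
  have step : ∀ x, (swap a b * σ).SameCycle x (σ x) := by
    intro x
    by_cases h1 : σ x = a
    · rw [h1]
      exact (auxa x ⟨-1, by simp [← h1]⟩).symm
    by_cases h2 : σ x = b
    · rw [h2]
      exact (auxb x ⟨-1, by simp [← h2]⟩).symm
    exact ⟨1, by simp [swap_apply_of_ne_of_ne h1 h2]⟩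
  intro x y hxy
  obtain ⟨i, rfl⟩ := hxy.exists_nat_pow_eq
  induction i with
  | zero => exact SameCycle.refl _ _
  | succ i ih =>
    rw [pow_succ', Perm.mul_apply]
    exact (ih ⟨i, by simp⟩).trans (step _)

theorem sameCycle_invariant {V : Type*} {σ : Perm V} {D : V → Prop}
    (hD : ∀ v, D (σ v) ↔ D v) {x y : V} (h : σ.SameCycle x y) : D x ↔ D y := by
  obtain ⟨i, rfl⟩ := h
  induction i with
  | zero => simp
  | succ i ih => rw [add_comm, zpow_add, Perm.mul_apply, zpow_one, hD, ih]
  | pred i ih =>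
    rw [ih, sub_eq_add_neg, add_comm, zpow_add, Perm.mul_apply, ← hD ((σ ^ (-1 : ℤ)) _)]
    simp

theorem list_prod_invariant {V : Type*} {D : V → Prop} (l : List (Perm V))
    (h : ∀ σ ∈ l, ∀ v, D (σ v) ↔ D v) (v : V) : D (l.prod v) ↔ D v := by
  induction l with
  | nil => simp
  | cons σ l ih =>
    rw [List.prod_cons, Perm.mul_apply, h σ (by simp), ih fun τ hτ => h τ (by simp [hτ])]

theorem swap_invariant {V : Type*} [DecidableEq V] {D : V → Prop} {a b : V} (h : D a ↔ D b)
    (v : V) : D (swap a b v) ↔ D v := by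
  rw [swap_apply_def]
  split_ifs with h1 h2
  · rw [h1, h]
  · rw [h2, h]
  · rfl

/-- The parent function `p` contains no cycle: every element of `A` is connected to a root
in `B` by iterating `p`. -/
def IsForest {A B : Type*} (p : A → A ⊕ B) : Prop :=
  ∃ h : A → ℕ, ∀ a a', p a = Sum.inl a' → h a' < h a

universe u

theorem IsForest.exists_isRight {A B : Type*} [Nonempty A] {p : A → A ⊕ B} (hp : IsForest p) :
    ∃ a, (p a).isRight := by
  obtain ⟨h, hh⟩ := hp
  let a := Function.argmin h
  refine ⟨a, ?_⟩
  rcases e : p a with a' | b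
  · exact absurd (hh a a' e) (Function.not_lt_argmin h a')
  · rfl

theorem card_isForest_fiber {A B : Type*} [Fintype A] [Fintype B] (S : Set A)
    [DecidablePred (· ∈ S)] :
    Nat.card {p : A → A ⊕ B // IsForest p ∧ ∀ k, (p k).isRight ↔ k ∈ S} =
      Fintype.card B ^ Fintype.card {a // a ∈ S} *
        Nat.card {q : {a // a ∉ S} → {a // a ∉ S} ⊕ {a // a ∈ S} // IsForest q} := by
  rw [← Nat.card_eq_fintype_card (α := B), ← Nat.card_eq_fintype_card (α := {a // a ∈ S}),
    ← Nat.card_fun, ← Nat.card_prod]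
  let G : ({a // a ∈ S} → B) → ({a // a ∉ S} → {a // a ∉ S} ⊕ {a // a ∈ S}) → A → A ⊕ B :=
    fun f q a => if h : a ∈ S then Sum.inr (f ⟨a, h⟩) else
      Sum.inl (Sum.elim Subtype.val Subtype.val (q ⟨a, h⟩))
  have hG1 : ∀ f q (a : {a // a ∈ S}), G f q a = Sum.inr (f a) := fun f q a => by
    simp [G, a.2]
  have hG2 : ∀ f q (a : {a // a ∉ S}), G f q a = Sum.inl (Sum.elim Subtype.val Subtype.val (q a)) :=
    fun f q a => by simp [G, a.2]
  have hinj : ∀ x y : {a // a ∉ S} ⊕ {a // a ∈ S},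
      Sum.elim Subtype.val Subtype.val x = Sum.elim Subtype.val Subtype.val y → x = y := by
    rintro (x | x) (y | y) h
    · exact congrArg Sum.inl (Subtype.ext h)
    · exact absurd y.2 (by rw [← show x.1 = y.1 from h]; exact x.2)
    · exact absurd x.2 (by rw [show x.1 = y.1 from h]; exact y.2)
    · exact congrArg Sum.inr (Subtype.ext h)
  refine (Nat.card_congr (Equiv.ofBijective (fun x => ⟨G x.1 x.2.1, ?forest, ?root⟩)
    ⟨?inj, ?surj⟩)).symm
  case forest =>
    obtain ⟨h, hh⟩ := x.2.2
    refine ⟨fun a => if ha : a ∈ S then 0 else h ⟨a, ha⟩ + 1, fun a a' e => ?_⟩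
    by_cases ha : a ∈ S
    · rw [hG1 _ _ ⟨a, ha⟩] at e
      exact absurd e (by simp)
    · rw [hG2 _ _ ⟨a, ha⟩] at e
      rcases e2 : x.2.1 ⟨a, ha⟩ with y | y
      · rw [e2] at e
        obtain rfl : y.1 = a' := Sum.inl_injective e
        simpa [ha, y.2] using hh _ _ e2
      · rw [e2] at e
        obtain rfl : y.1 = a' := Sum.inl_injective e
        simp [ha, y.2]
  case root =>
    intro k
    by_cases hk : k ∈ S
    · simp [hG1 _ _ ⟨k, hk⟩, hk]
    · simp [hG2 _ _ ⟨k, hk⟩, hk]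
  case inj =>
    rintro ⟨f, q, hq⟩ ⟨f', q', hq'⟩ h
    have h' : G f q = G f' q' := congrArg Subtype.val h
    have hf : f = f' := by
      funext a
      have := congrFun h' a
      rw [hG1, hG1] at this
      exact Sum.inr_injective this
    have hqq : q = q' := by
      funext a
      have := congrFun h' a
      rw [hG2, hG2] at this
      exact hinj _ _ (Sum.inl_injective this)
    subst hf hqq
    rfl
  case surj =>
    rintro ⟨p, ⟨h, hh⟩, hS⟩
    have hr : ∀ a : {a // a ∈ S}, ∃ b, p a = Sum.inr b := fun a =>
      Sum.isRight_iff.1 ((hS a).2 a.2)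
    have hl : ∀ a : {a // a ∉ S}, ∃ x : {a // a ∉ S} ⊕ {a // a ∈ S},
        p a = Sum.inl (Sum.elim Subtype.val Subtype.val x) := by
      intro a
      rcases e : p a with y | y
      · by_cases hy : y ∈ S
        · exact ⟨Sum.inr ⟨y, hy⟩, rfl⟩
        · exact ⟨Sum.inl ⟨y, hy⟩, rfl⟩
      · exact absurd ((hS a).1 (by rw [e]; rfl)) a.2
    choose f hf using hr
    choose q hq using hl
    refine ⟨⟨f, q, fun a => h a, fun a a' e => ?_⟩, Subtype.ext (funext fun a => ?_)⟩
    · exact hh _ _ (by rw [hq, e]; rfl)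
    · by_cases ha : a ∈ S
      · exact (hG1 f q ⟨a, ha⟩).trans (hf ⟨a, ha⟩).symm
      · exact (hG2 f q ⟨a, ha⟩).trans (hq ⟨a, ha⟩).symm

theorem card_isForest_eq_sum (A B : Type*) [Fintype A] [Finite B] :
    Nat.card {p : A → A ⊕ B // IsForest p} = ∑ S : Finset A,
      Nat.card {p : A → A ⊕ B // IsForest p ∧ ∀ k, (p k).isRight ↔ k ∈ (S : Set A)} := by
  classical
  rw [← Nat.card_congr (Equiv.sigmaFiberEquiv fun p : {p : A → A ⊕ B // IsForest p} =>
    Finset.univ.filter fun k => (p.1 k).isRight), Nat.card_sigma]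
  refine Finset.sum_congr rfl fun S _ => Nat.card_congr ?_
  refine (Equiv.subtypeSubtypeEquivSubtypeInter IsForest
    (fun p : A → A ⊕ B => (Finset.univ.filter fun k => (p k).isRight) = S)).trans
    (Equiv.subtypeEquivRight fun p => and_congr_right fun _ => ?_)
  simp [Finset.ext_iff]

theorem sum_choose_mul_pow_mul_pow (n b : ℕ) :
    ∑ k ∈ Finset.range (n + 2), (n + 1).choose k * (b ^ k * (k * (n + 1) ^ (n + 1 - k))) =
      (n + 1) * (b * (n + 1 + b) ^ n) := by
  rw [Finset.sum_range_succ', add_comm (n + 1) b, add_pow b (n + 1) n, Finset.mul_sum,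
    Finset.mul_sum]
  simp only [zero_mul, mul_zero, add_zero]
  refine Finset.sum_congr rfl fun k _ => ?_
  have h := Nat.add_one_mul_choose_eq n k
  rw [Nat.add_sub_add_right]
  simp only [Nat.cast_id]
  calc (n + 1).choose (k + 1) * (b ^ (k + 1) * ((k + 1) * (n + 1) ^ (n - k)))
      = (n + 1).choose (k + 1) * (k + 1) * (b ^ (k + 1) * (n + 1) ^ (n - k)) := by ring
    _ = _ := by rw [← h]; ring

theorem card_isForest_of_isEmpty {A B : Type*} [IsEmpty A] :
    Nat.card {p : A → A ⊕ B // IsForest p} = 1 := by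
  rw [Nat.card_eq_one_iff_unique]
  exact ⟨inferInstance, ⟨⟨isEmptyElim, fun _ => 0, isEmptyElim⟩⟩⟩

theorem card_isForest_of_card_eq {n : ℕ} : ∀ {A B : Type u} [Fintype A] [Fintype B],
    Fintype.card A = n →
    (Fintype.card A + Fintype.card B) * Nat.card {p : A → A ⊕ B // IsForest p} =
      Fintype.card B * (Fintype.card A + Fintype.card B) ^ Fintype.card A := by
  classical
  induction n using Nat.strong_induction_on with
  | _ n ih =>
    intro A B _ _ hn
    rcases n with _ | n
    · have := Fintype.card_eq_zero_iff.1 hn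
      rw [card_isForest_of_isEmpty, hn]
      simp
    have : Nonempty A := Fintype.card_pos_iff.1 (by omega)
    have hS : ∀ S : Finset A, (n + 1) *
        Nat.card {p : A → A ⊕ B // IsForest p ∧ ∀ k, (p k).isRight ↔ k ∈ (S : Set A)} =
        Fintype.card B ^ S.card * (S.card * (n + 1) ^ (n + 1 - S.card)) := by
      intro S
      rcases S.eq_empty_or_nonempty with rfl | hne
      · rw [Finset.card_empty, zero_mul, mul_zero]
        refine mul_eq_zero_of_right _ (Nat.card_eq_zero.2 (Or.inl ⟨?_⟩))
        rintro ⟨p, hp, h⟩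
        obtain ⟨a, ha⟩ := hp.exists_isRight
        simpa using (h a).1 ha
      · have h1 : Fintype.card {a // a ∈ (S : Set A)} = S.card := by simp
        have h2 : Fintype.card {a // a ∉ (S : Set A)} = n + 1 - S.card := by
          rw [Fintype.card_subtype_compl, h1, hn]
        have h3 : S.card ≤ n + 1 := hn ▸ S.card_le_univ
        have h4 := hne.card_pos
        have := ih (n + 1 - S.card) (by omega) (B := {a // a ∈ (S : Set A)}) h2
        rw [h1, h2, Nat.sub_add_cancel h3] at this
        rw [card_isForest_fiber, ← this]
        simp only [Finset.mem_coe, Fintype.card_coe]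
        ring
    have hsum : (n + 1) * Nat.card {p : A → A ⊕ B // IsForest p} =
        (n + 1) * (Fintype.card B * (n + 1 + Fintype.card B) ^ n) := by
      rw [card_isForest_eq_sum, Finset.mul_sum, Finset.sum_congr rfl fun S _ => hS S,
        ← sum_choose_mul_pow_mul_pow, ← Finset.powerset_univ,
        Finset.sum_powerset_apply_card
          (fun k => Fintype.card B ^ k * (k * (n + 1) ^ (n + 1 - k))),
        Finset.card_univ, hn]
      simp
    rw [hn, Nat.eq_of_mul_eq_mul_left (Nat.succ_pos n) hsum]
    ring

/-- The number of rooted forests with non-root vertices `A` and set of roots `B`, in a form that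
stays correct when `A` is empty. -/
theorem card_isForest {A B : Type u} [Fintype A] [Fintype B] :
    (Fintype.card A + Fintype.card B) * Nat.card {p : A → A ⊕ B // IsForest p} =
      Fintype.card B * (Fintype.card A + Fintype.card B) ^ Fintype.card A :=
  card_isForest_of_card_eq rfl

section Forest

variable {A : Type*} {p : A → A ⊕ Unit}

theorem IsForest.ne_inl {B : Type*} {p : A → A ⊕ B} (hp : IsForest p) (k : A) :
    Sum.inl k ≠ p k := by
  obtain ⟨h, hh⟩ := hp
  exact fun e => lt_irrefl _ (hh k k e.symm)

theorem IsForest.exists_separating (hp : IsForest p) (k : A) :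
    ∃ D : A ⊕ Unit → Prop, D (Sum.inl k) ∧ ¬ D (p k) ∧ ∀ j, j ≠ k → (D (Sum.inl j) ↔ D (p j)) := by
  obtain ⟨h, hh⟩ := hp
  let next : A ⊕ Unit → A ⊕ Unit := Sum.elim p Sum.inr
  let H : A ⊕ Unit → ℕ := Sum.elim (fun a => h a + 1) (fun _ => 0)
  have hlt : ∀ a, H (p a) < H (Sum.inl a) := by
    intro a
    rcases e : p a with a' | u
    · simpa [H] using hh a a' e
    · simp [H]
  have hle : ∀ v, H (next v) ≤ H v := by
    rintro (a | u)
    · exact (hlt a).le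
    · exact le_rfl
  have hit : ∀ i v, H (next^[i] v) ≤ H v := by
    intro i
    induction i with
    | zero => exact fun v => le_rfl
    | succ i ih => exact fun v => (ih _).trans (hle v)
  refine ⟨fun v => ∃ i, next^[i] v = Sum.inl k, ⟨0, rfl⟩, ?_, ?_⟩
  · rintro ⟨i, hi⟩
    have := hit i (p k)
    rw [hi] at this
    exact absurd (hlt k) (not_lt.2 this)
  · intro j hj
    constructor
    · rintro ⟨_ | i, hi⟩
      · exact absurd (Sum.inl_injective hi) hj
      · exact ⟨i, hi⟩
    · rintro ⟨i, hi⟩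
      exact ⟨i + 1, hi⟩

variable [DecidableEq A]

/-- The transposition exchanging a non-root vertex with its parent. -/
def edgeSwap (p : A → A ⊕ Unit) (k : A) : Perm (A ⊕ Unit) := swap (Sum.inl k) (p k)

theorem IsForest.sameCycle_edge [Finite A] (hp : IsForest p) (l : List A) (hl : l.Nodup) :
    ∀ k ∈ l, ((l.map (edgeSwap p)).prod).SameCycle (Sum.inl k) (p k) := by
  induction l with
  | nil => simp
  | cons k l ih =>
    rw [List.nodup_cons] at hl
    obtain ⟨D, hk, hpk, hD⟩ := hp.exists_separating k
    have hn : ¬ ((l.map (edgeSwap p)).prod).SameCycle (Sum.inl k) (p k) := by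
      intro hs
      refine hpk ((sameCycle_invariant (D := D) (list_prod_invariant _ ?_) hs).1 hk)
      intro σ hσ v
      obtain ⟨j, hj, rfl⟩ := List.mem_map.1 hσ
      exact swap_invariant (hD j fun e => hl.1 (e ▸ hj)) v
    have := sameCycle_swap_mul hn
    rw [List.map_cons, List.prod_cons]
    intro j hj
    rcases List.mem_cons.1 hj with rfl | hj
    · exact this.1
    · exact this.2 _ _ (ih hl.2 j hj)

theorem IsForest.sameCycle_root [Finite A] (hp : IsForest p) (l : List A) (hl : l.Nodup)
    (hmem : ∀ k, k ∈ l) (v : A ⊕ Unit) :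
    ((l.map (edgeSwap p)).prod).SameCycle (Sum.inr ()) v := by
  have he := hp.sameCycle_edge l hl
  obtain ⟨h, hh⟩ := hp
  rcases v with a | u
  · induction hn : h a using Nat.strong_induction_on generalizing a with
    | _ n ih =>
      have h1 := he a (hmem a)
      rcases e : p a with a' | u
      · rw [e] at h1
        exact (ih (h a') (hn ▸ hh a a' e) a' rfl).trans h1.symm
      · rw [e] at h1
        exact h1.symm
  · exact SameCycle.refl _ _

end Forest

theorem exists_equiv_finRotate {V : Type*} [Fintype V] {N : ℕ} (hV : Fintype.card V = N + 1)
    (σ : Perm V) (v₀ : V) (hσ : ∀ v, σ.SameCycle v₀ v) :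
    ∃ e : V ≃ Fin (N + 1), e v₀ = 0 ∧ ∀ v, e (σ v) = finRotate (N + 1) (e v) := by
  classical
  have hper : ∀ v, ∃ i < Function.minimalPeriod σ v₀, (σ ^ i) v₀ = v := by
    intro v
    obtain ⟨i, rfl⟩ := (hσ v).exists_nat_pow_eq
    have hpos : 0 < Function.minimalPeriod σ v₀ :=
      Function.minimalPeriod_pos_of_mem_periodicPts
        (Function.Injective.mem_periodicPts σ.injective v₀)
    refine ⟨i % Function.minimalPeriod σ v₀, Nat.mod_lt _ hpos, ?_⟩
    rw [Perm.coe_pow, Perm.coe_pow, Function.iterate_mod_minimalPeriod_eq]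
  let f' : Fin (Function.minimalPeriod σ v₀) → V := fun i => (σ ^ (i : ℕ)) v₀
  have hf' : Function.Bijective f' := by
    refine ⟨fun i j hij => Fin.ext ?_, fun v => ?_⟩
    · simp only [f', Perm.coe_pow] at hij
      exact Function.iterate_injOn_Iio_minimalPeriod i.2 j.2 hij
    · obtain ⟨i, hi, h⟩ := hper v
      exact ⟨⟨i, hi⟩, h⟩
  have hN : Function.minimalPeriod σ v₀ = N + 1 := by
    rw [← hV, ← Fintype.card_of_bijective hf', Fintype.card_fin]
  have hcyc : (σ ^ (N + 1)) v₀ = v₀ := by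
    rw [Perm.coe_pow, ← hN, Function.iterate_minimalPeriod]
  let g := (finCongr hN.symm).trans (Equiv.ofBijective f' hf')
  have hg : ∀ i : Fin (N + 1), g i = (σ ^ (i : ℕ)) v₀ := fun i => rfl
  refine ⟨g.symm, by rw [Equiv.symm_apply_eq, hg]; simp, fun v => ?_⟩
  obtain ⟨i, rfl⟩ := g.surjective v
  rw [Equiv.symm_apply_eq, Equiv.symm_apply_apply, hg, hg, ← Perm.mul_apply, ← pow_succ']
  rw [finRotate_apply]
  rcases eq_or_ne i (Fin.last N) with rfl | hi
  · simp [hcyc]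
  · rw [Fin.val_add_one_of_lt (Fin.lt_last_iff_ne_last.2 hi)]

section MinFact

variable {N : ℕ} {p : Fin N → Fin N ⊕ Unit} {e : Fin N ⊕ Unit ≃ Fin (N + 1)}

theorem isMinFact_permCongr_iff :
    IsMinFact (N + 1) (fun k => e.permCongr (edgeSwap p k)) ↔
      (∀ k, Sum.inl k ≠ p k) ∧ ∀ v,
        e ((((List.finRange N).reverse.map (edgeSwap p)).prod) v) = finRotate (N + 1) (e v) := by
  have h1 : (List.ofFn (fun k => e.permCongr (edgeSwap p k))).reverse.prod =
      e.permCongr (((List.finRange N).reverse.map (edgeSwap p)).prod) := by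
    change _ = e.permCongrHom _
    rw [map_list_prod, List.map_map, List.map_reverse, List.ofFn_eq_map]
    rfl
  have h2 : ∀ k, e.permCongr (edgeSwap p k) = swap (e (Sum.inl k)) (e (p k)) := fun k =>
    Equiv.symm_trans_swap_trans _ _ e
  unfold IsMinFact
  refine and_congr (forall_congr' fun k => ?_) ?_
  · constructor
    · rintro ⟨a, b, hab, h⟩ he
      replace h := (h2 k).symm.trans h
      rw [← he, swap_self] at h
      exact hab (swap_eq_refl_iff.1 h.symm)
    · exact fun h => ⟨_, _, fun he => h (e.injective he), h2 k⟩
  · refine Iff.trans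
      (b := e.permCongr (((List.finRange N).reverse.map (edgeSwap p)).prod) = finRotate (N + 1))
      (by rw [← h1]; rfl) ?_
    constructor
    · intro h v
      rw [← h]
      simp
    · intro h
      ext1 v
      simpa using h (e.symm v)

theorem IsForest.exists_isMinFact (hp : IsForest p) :
    ∃ e : Fin N ⊕ Unit ≃ Fin (N + 1), e (Sum.inr ()) = 0 ∧
      IsMinFact (N + 1) (fun k => e.permCongr (edgeSwap p k)) := by
  obtain ⟨e, he0, he⟩ := exists_equiv_finRotate (V := Fin N ⊕ Unit) (N := N) (by simp) _ _
    (hp.sameCycle_root (List.finRange N).reverse (by simp [List.nodup_finRange]) (by simp))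
  exact ⟨e, he0, isMinFact_permCongr_iff.2 ⟨hp.ne_inl, he⟩⟩

theorem IsForest.equiv_unique (hp : IsForest p) {e e' : Fin N ⊕ Unit ≃ Fin (N + 1)}
    (h0 : e (Sum.inr ()) = 0) (h0' : e' (Sum.inr ()) = 0)
    (he : IsMinFact (N + 1) (fun k => e.permCongr (edgeSwap p k)))
    (he' : IsMinFact (N + 1) (fun k => e'.permCongr (edgeSwap p k))) : e = e' := by
  have h1 := (isMinFact_permCongr_iff.1 he).2
  have h2 := (isMinFact_permCongr_iff.1 he').2
  ext1 v
  have hs := hp.sameCycle_root (List.finRange N).reverse (by simp [List.nodup_finRange]) (by simp) v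
  refine (sameCycle_invariant (D := fun v => e v = e' v) (fun w => ?_) hs).1 (h0.trans h0'.symm)
  rw [h1, h2, EmbeddingLike.apply_eq_iff_eq]

theorem IsForest.eq_of_permCongr_eq {p' : Fin N → Fin N ⊕ Unit} (hp : IsForest p)
    {e e' : Fin N ⊕ Unit ≃ Fin (N + 1)}
    (h0 : e (Sum.inr ()) = 0) (h0' : e' (Sum.inr ()) = 0)
    (h : ∀ k, e.permCongr (edgeSwap p k) = e'.permCongr (edgeSwap p' k)) : p = p' := by
  let g := e.trans e'.symm
  have hg : ∀ k, swap (g (Sum.inl k)) (g (p k)) = swap (Sum.inl k) (p' k) := by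
    intro k
    have h2 : swap (e (Sum.inl k)) (e (p k)) = swap (e' (Sum.inl k)) (e' (p' k)) := by
      have := h k
      rwa [edgeSwap, edgeSwap, Equiv.permCongr_def, Equiv.permCongr_def,
        Equiv.symm_trans_swap_trans, Equiv.symm_trans_swap_trans] at this
    have := congrArg (fun σ => (e'.trans σ).trans e'.symm) h2
    have h3 := fun a b => Equiv.symm_trans_swap_trans a b e'.symm
    simp only [Equiv.symm_symm] at h3
    simpa [h3, g] using this
  have hne := hp.ne_inl
  have hr : g (Sum.inr ()) = Sum.inr () := by simp [g, h0, ← h0']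
  have hfix : ∀ k, g (p k) = p k → p k = p' k ∧ g (Sum.inl k) = Sum.inl k := by
    intro k hk
    have hgk := hg k
    rw [hk] at hgk
    have hne' : g (Sum.inl k) ≠ p k := by
      rw [← hk]
      exact fun h => hne k (g.injective h)
    have hx : swap (Sum.inl k) (p' k) (p k) = g (Sum.inl k) := by
      rw [← hgk, swap_apply_right]
    rw [swap_apply_def, if_neg (hne k).symm] at hx
    split_ifs at hx with h1
    · exact ⟨h1, hx.symm⟩
    · exact absurd hx.symm hne'
  obtain ⟨h, hh⟩ := hp
  have hinl : ∀ k, g (Sum.inl k) = Sum.inl k := by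
    intro k
    induction hn : h k using Nat.strong_induction_on generalizing k with
    | _ n ih =>
      refine (hfix k ?_).2
      rcases e : p k with a' | u
      · exact ih _ (hn ▸ hh k a' e) a' rfl
      · exact hr
  funext k
  refine (hfix k ?_).1
  rcases e : p k with a' | u
  · exact hinl a'
  · exact hr

theorem IsMinFact.exists_height {F : Fin N → Perm (Fin (N + 1))} (hF : IsMinFact (N + 1) F) :
    ∃ h : Fin (N + 1) → ℕ, ∀ v, v ≠ 0 → ∃ k u, F k = swap v u ∧ h u < h v := by
  let G : SimpleGraph (Fin (N + 1)) :=
    { Adj := fun a b => a ≠ b ∧ ∃ k, F k = swap a b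
      symm := ⟨fun a b h => ⟨h.1.symm, h.2.imp fun k hk => by rw [hk, swap_comm]⟩⟩
      loopless := ⟨fun a h => h.1 rfl⟩ }
  have hrot : ∀ v, G.Reachable (finRotate (N + 1) v) 0 ↔ G.Reachable v 0 := by
    intro v
    rw [← hF.2]
    refine list_prod_invariant (D := fun v => G.Reachable v 0) _ (fun σ hσ => ?_) v
    obtain ⟨k, rfl⟩ := (List.mem_ofFn' _ _).1 (List.mem_reverse.1 hσ)
    obtain ⟨a, b, hab, h⟩ := hF.1 k
    have hadj : G.Adj a b := ⟨hab, k, h⟩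
    intro v
    rw [h]
    exact swap_invariant (D := fun v => G.Reachable v 0)
      ⟨fun hr => hadj.symm.reachable.trans hr, fun hr => hadj.reachable.trans hr⟩ v
  have hreach : ∀ v, G.Reachable v 0 := by
    intro v
    induction v using Fin.induction with
    | zero => exact SimpleGraph.Reachable.refl _
    | succ i ih =>
      have := (hrot i.castSucc).2 ih
      rwa [finRotate_apply, Fin.coeSucc_eq_succ] at this
  refine ⟨fun v => G.dist v 0, fun v hv => ?_⟩
  obtain ⟨w, hw⟩ := (hreach v).exists_walk_length_eq_dist
  cases w with
  | nil => exact absurd rfl hv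
  | cons hadj w =>
    obtain ⟨k, hk⟩ := hadj.2
    refine ⟨k, _, hk, ?_⟩
    have := SimpleGraph.dist_le w
    rw [SimpleGraph.Walk.length_cons] at hw
    dsimp only
    omega

theorem IsMinFact.exists_isForest {F : Fin N → Perm (Fin (N + 1))} (hF : IsMinFact (N + 1) F) :
    ∃ (p : Fin N → Fin N ⊕ Unit) (e : Fin N ⊕ Unit ≃ Fin (N + 1)), IsForest p ∧
      e (Sum.inr ()) = 0 ∧ F = fun k => e.permCongr (edgeSwap p k) := by
  obtain ⟨h, hh⟩ := hF.exists_height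
  choose κ u hκ hu using fun i : Fin N => hh i.succ (Fin.succ_ne_zero i)
  have hinj : Function.Injective κ := by
    intro i j hij
    have hs : swap i.succ (u i) = swap j.succ (u j) := by rw [← hκ, ← hκ, hij]
    have h1 : swap j.succ (u j) i.succ = u i := by rw [← hs, swap_apply_left]
    rw [swap_apply_def] at h1
    have hi := hu i
    have hj := hu j
    split_ifs at h1 with h2 h3
    · exact Fin.succ_injective _ h2
    · have e1 := congrArg h h1
      have e3 := congrArg h h3
      omega
    · rw [← h1] at hi
      omega
  let κe : Fin N ≃ Fin N := Equiv.ofBijective κ (Finite.injective_iff_bijective.1 hinj)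
  have hκe : ∀ k, F k = swap (κe.symm k).succ (u (κe.symm k)) := by
    intro k
    rw [← hκ]
    exact congrArg F (κe.apply_symm_apply k).symm
  let f : Fin N ⊕ Unit → Fin (N + 1) := Sum.elim (fun k => (κe.symm k).succ) (fun _ => 0)
  have hf : Function.Bijective f := by
    constructor
    · rintro (a | a) (b | b) hab
      · simpa [f] using hab
      · simp [f] at hab
      · exact absurd hab.symm (Fin.succ_ne_zero _)
      · rfl
    · intro v
      rcases Fin.eq_zero_or_eq_succ v with rfl | ⟨j, rfl⟩
      · exact ⟨Sum.inr (), rfl⟩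
      · exact ⟨Sum.inl (κe j), by simp [f]⟩
  let e := Equiv.ofBijective f hf
  have hel : ∀ k, e (Sum.inl k) = (κe.symm k).succ := fun k => rfl
  refine ⟨fun k => e.symm (u (κe.symm k)), e, ⟨fun a => h (κe.symm a).succ, fun a a' ha => ?_⟩,
    rfl, ?_⟩
  · rw [Equiv.symm_apply_eq, hel] at ha
    change h (κe.symm a').succ < _
    rw [← ha]
    exact hu _
  · funext k
    rw [edgeSwap, Equiv.permCongr_def, Equiv.symm_trans_swap_trans, Equiv.apply_symm_apply,
      hel, hκe]

theorem permCongr_edgeSwap_zero_ne_zero_iff (h0 : e (Sum.inr ()) = 0)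
    (k : Fin N) : e.permCongr (edgeSwap p k) 0 ≠ 0 ↔ (p k).isRight := by
  rw [Equiv.permCongr_apply, ← h0, Equiv.symm_apply_apply, Ne, EmbeddingLike.apply_eq_iff_eq,
    edgeSwap]
  rcases h : p k with a | u
  · simp [swap_apply_of_ne_of_ne]
  · simp

theorem card_isMinFact_eq_card_isForest (S : Set (Fin N)) :
    Nat.card {F : Fin N → Perm (Fin (N + 1)) //
        IsMinFact (N + 1) F ∧ ∀ k, F k 0 ≠ 0 ↔ k ∈ S} =
      Nat.card {p : Fin N → Fin N ⊕ Unit // IsForest p ∧ ∀ k, (p k).isRight ↔ k ∈ S} := by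
  choose φ ε hφ hε hF using fun F : {F : Fin N → Perm (Fin (N + 1)) //
        IsMinFact (N + 1) F ∧ ∀ k, F k 0 ≠ 0 ↔ k ∈ S} => F.2.1.exists_isForest
  refine Nat.card_congr (Equiv.ofBijective (fun F => ⟨φ F, hφ F, fun k => ?_⟩) ⟨?_, ?_⟩)
  · rw [← F.2.2 k, hF F, permCongr_edgeSwap_zero_ne_zero_iff (hε F)]
  · intro F F' h
    have h' : φ F = φ F' := congrArg Subtype.val h
    have hm := F.2.1
    have hm' := F'.2.1
    rw [hF F] at hm
    rw [hF F', ← h'] at hm'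
    have he := (hφ F).equiv_unique (hε F) (hε F') hm hm'
    apply Subtype.ext
    rw [hF F, hF F', h', he]
  · rintro ⟨p, hp, hS⟩
    obtain ⟨e, h0, he⟩ := hp.exists_isMinFact
    let F : {F : Fin N → Perm (Fin (N + 1)) //
        IsMinFact (N + 1) F ∧ ∀ k, F k 0 ≠ 0 ↔ k ∈ S} :=
      ⟨_, he, fun k => by rw [permCongr_edgeSwap_zero_ne_zero_iff h0, hS]⟩
    refine ⟨F, Subtype.ext ?_⟩
    exact (hp.eq_of_permCongr_eq h0 (hε F) fun k => congrFun (hF F) k).symm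

end MinFact

theorem card_isMinFact_of_moving {N : ℕ} (S : Finset (Fin N)) :
    N * Nat.card {F : Fin N → Perm (Fin (N + 1)) //
        IsMinFact (N + 1) F ∧ ∀ k, F k 0 ≠ 0 ↔ k ∈ (S : Set (Fin N))} =
      S.card * N ^ (N - S.card) := by
  have h1 : Fintype.card {a // a ∈ (S : Set (Fin N))} = S.card := by simp
  have h2 : Fintype.card {a // a ∉ (S : Set (Fin N))} = N - S.card := by
    rw [Fintype.card_subtype_compl, h1, Fintype.card_fin]
  have h3 : S.card ≤ N := by simpa using S.card_le_univ
  have := card_isForest (A := {a // a ∉ (S : Set (Fin N))}) (B := {a // a ∈ (S : Set (Fin N))})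
  rw [h1, h2, Nat.sub_add_cancel h3] at this
  rw [card_isMinFact_eq_card_isForest, card_isForest_fiber, Fintype.card_unit, one_pow, one_mul,
    this]

theorem card_isMinFact_moving_times {N m : ℕ} (Q : (Fin m → Fin N) → Prop) :
    N * Nat.card {F : Fin N → Perm (Fin (N + 1)) // IsMinFact (N + 1) F ∧
        ∃ t : Fin m → Fin N, StrictMono t ∧ (∀ k, F k 0 ≠ 0 ↔ ∃ l, t l = k) ∧ Q t} =
      Nat.card {t : Fin m → Fin N // StrictMono t ∧ Q t} * (m * N ^ (N - m)) := by
  classical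
  let f : (Σ t : {t : Fin m → Fin N // StrictMono t ∧ Q t}, {F : Fin N → Perm (Fin (N + 1)) //
        IsMinFact (N + 1) F ∧ ∀ k, F k 0 ≠ 0 ↔ k ∈ (Finset.univ.image t.1 : Set (Fin N))}) →
      {F : Fin N → Perm (Fin (N + 1)) // IsMinFact (N + 1) F ∧
        ∃ t : Fin m → Fin N, StrictMono t ∧ (∀ k, F k 0 ≠ 0 ↔ ∃ l, t l = k) ∧ Q t} :=
    fun z => ⟨z.2.1, z.2.2.1, z.1.1, z.1.2.1, fun k => (z.2.2.2 k).trans (by simp), z.1.2.2⟩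
  have hf : Function.Bijective f := by
    constructor
    · rintro ⟨⟨t, ht, hQ⟩, F, hF, h⟩ ⟨⟨t', ht', hQ'⟩, F', hF', h'⟩ e
      obtain rfl : F = F' := congrArg Subtype.val e
      obtain rfl : t = t' := by
        refine (ht.range_inj ht').1 (Set.ext fun k => ?_)
        simpa using (h k).symm.trans (h' k)
      rfl
    · rintro ⟨F, hF, t, ht, h, hQ⟩
      exact ⟨⟨⟨t, ht, hQ⟩, F, hF, fun k => (h k).trans (by simp)⟩, rfl⟩
  rw [← Nat.card_congr (Equiv.ofBijective f hf), Nat.card_sigma, Finset.mul_sum,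
    Finset.sum_congr rfl fun t _ => card_isMinFact_of_moving (Finset.univ.image t.1)]
  have hc : ∀ t : {t : Fin m → Fin N // StrictMono t ∧ Q t}, (Finset.univ.image t.1).card = m :=
    fun t => by rw [Finset.card_image_of_injective _ t.2.1.injective, Finset.card_fin]
  simp only [hc, Finset.sum_const, Finset.card_univ, Nat.card_eq_fintype_card, smul_eq_mul]

end Counting

section Limit

open Filter Topology
open scoped Pointwise

/-- The region of increasing `m`-tuples of positive reals bounded coordinatewise by `x`. -/
def orderedRegion {m : ℕ} (x : Fin m → ℝ) : Set (Fin m → ℝ) :=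
  {y | (∀ l, 0 < y l ∧ y l ≤ x l) ∧ ∀ i j, i < j → y i < y j}

theorem card_moving_times {N m : ℕ} {x : Fin m → ℝ} (hx : ∀ k, x k < 1) :
    Nat.card {t : Fin m → Fin N // StrictMono t ∧
        ∀ l, ((t l : ℕ) + 1 : ℝ) ≤ x l * ((N + 1 : ℕ) : ℝ)} =
      Nat.card ↑(orderedRegion x ∩ (((N + 1 : ℕ) : ℝ)⁻¹ •
        Submodule.span ℤ (Set.range (Pi.basisFun ℝ (Fin m))) : Submodule ℤ (Fin m → ℝ))) := by
  have hpos : (0 : ℝ) < ((N + 1 : ℕ) : ℝ) := by positivity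
  refine Nat.card_congr (Equiv.ofBijective
    (fun t => ⟨fun l => ((t.1 l : ℕ) + 1 : ℝ) / ((N + 1 : ℕ) : ℝ),
      ⟨⟨fun l => ⟨?pos, ?le⟩, ?mono⟩, ?lattice⟩⟩)
    ⟨?inj, ?surj⟩)
  case inj =>
    rintro ⟨t, ht⟩ ⟨t', ht'⟩ h
    refine Subtype.ext (funext fun l => Fin.ext ?_)
    have := (div_left_inj' hpos.ne').1 (congrFun (congrArg Subtype.val h) l)
    simpa using this
  case surj =>
    rintro ⟨y, ⟨hy, hmono⟩, hL⟩
    replace hL := BoxIntegral.unitPartition.mem_smul_span_iff.1 hL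
    choose z hz using hL
    have hz' : ∀ l, (z l : ℝ) = ((N + 1 : ℕ) : ℝ) * y l := hz
    have h0 : ∀ l, 1 ≤ z l := fun l => by
      have : (0 : ℝ) < z l := by rw [hz']; exact mul_pos hpos (hy l).1
      exact_mod_cast this
    have h1 : ∀ l, z l < N + 1 := fun l => by
      have : (z l : ℝ) < ((N + 1 : ℕ) : ℝ) := by
        rw [hz']
        exact mul_lt_of_lt_one_right hpos ((hy l).2.trans_lt (hx l))
      exact_mod_cast this
    have hcast : ∀ l, (((z l - 1).toNat : ℕ) : ℝ) + 1 = z l := fun l => by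
      have : (((z l - 1).toNat : ℤ)) + 1 = z l := by have := h0 l; omega
      exact_mod_cast this
    refine ⟨⟨fun l => ⟨(z l - 1).toNat, by have := h0 l; have := h1 l; omega⟩, ?_, ?_⟩, ?_⟩
    · intro i j hij
      have : (z i : ℝ) < z j := by
        rw [hz', hz']
        exact mul_lt_mul_of_pos_left (hmono i j hij) hpos
      have : z i < z j := by exact_mod_cast this
      have := h0 i
      rw [Fin.lt_def]
      dsimp only
      omega
    · intro l
      dsimp only
      rw [hcast, hz', mul_comm]
      exact mul_le_mul_of_nonneg_right (hy l).2 hpos.le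
    · refine Subtype.ext (funext fun l => ?_)
      dsimp only
      rw [hcast, hz', mul_div_cancel_left₀ _ hpos.ne']
  case pos =>
    dsimp only
    positivity
  case le =>
    dsimp only
    rw [div_le_iff₀ hpos]
    exact t.2.2 l
  case mono =>
    intro i j hij
    have := t.2.1 hij
    rw [Fin.lt_def] at this
    dsimp only
    gcongr
  case lattice =>
    refine BoxIntegral.unitPartition.mem_smul_span_iff.2 fun l => ⟨(t.1 l : ℕ) + 1, ?_⟩
    rw [mul_div_cancel₀ _ hpos.ne']
    simp

theorem convex_orderedRegion {m : ℕ} (x : Fin m → ℝ) : Convex ℝ (orderedRegion x) := by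
  rintro y ⟨hy, hy'⟩ z ⟨hz, hz'⟩ a b ha hb hab
  have key : ∀ {p q r s : ℝ}, p < q → r < s → a * p + b * r < a * q + b * s := by
    intro p q r s hpq hrs
    rcases ha.eq_or_lt with rfl | ha'
    · rw [zero_add] at hab
      simpa [hab] using hrs
    · exact add_lt_add_of_lt_of_le (mul_lt_mul_of_pos_left hpq ha')
        (mul_le_mul_of_nonneg_left hrs.le hb)
  refine ⟨fun l => ⟨?_, ?_⟩, fun i j hij => ?_⟩
  · simpa using key (hy l).1 (hz l).1
  · calc a * y l + b * z l ≤ a * x l + b * x l := by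
          gcongr
          exacts [(hy l).2, (hz l).2]
      _ = x l := by rw [← add_mul, hab, one_mul]
  · exact key (hy' i j hij) (hz' i j hij)

theorem measurableSet_orderedRegion {m : ℕ} (x : Fin m → ℝ) : MeasurableSet (orderedRegion x) := by
  unfold orderedRegion
  measurability

theorem isBounded_orderedRegion {m : ℕ} (x : Fin m → ℝ) :
    Bornology.IsBounded (orderedRegion x) :=
  (Metric.isBounded_Icc 0 x).subset fun _ hy => ⟨fun l => (hy.1 l).1.le, fun l => (hy.1 l).2⟩

theorem tendsto_card_moving_times {m : ℕ} {x : Fin m → ℝ} (hx : ∀ k, x k < 1) :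
    Tendsto (fun N : ℕ => (Nat.card {t : Fin m → Fin N // StrictMono t ∧
        ∀ l, ((t l : ℕ) + 1 : ℝ) ≤ x l * ((N + 1 : ℕ) : ℝ)} : ℝ) / ((N + 1 : ℕ) : ℝ) ^ m)
      atTop (𝓝 (MeasureTheory.volume.real (orderedRegion x))) := by
  have := (tendsto_card_div_pow_atTop_volume (orderedRegion x) (isBounded_orderedRegion x)
    (measurableSet_orderedRegion x) ((convex_orderedRegion x).addHaar_frontier _)).comp
    (tendsto_add_atTop_nat 1)
  refine this.congr fun N => ?_
  rw [card_moving_times hx, Fintype.card_fin]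
  rfl

theorem card_div_pow_eq {N m : ℕ} (hN : 1 ≤ N) (hm : m ≤ N) {c d : ℝ}
    (h : N * c = d * (m * N ^ (N - m))) :
    c / (N + 1 : ℝ) ^ (N - 1) =
      d / (N + 1 : ℝ) ^ m * (m * ((1 + 1 / (N : ℝ)) ^ N)⁻¹ * (1 + 1 / (N : ℝ)) ^ (m + 1)) := by
  have hN0 : (0 : ℝ) < N := by exact_mod_cast hN
  have hN1 : (0 : ℝ) < N + 1 := by positivity
  have hc : c = d * (m * N ^ (N - m)) / N := by rw [← h]; field_simp
  have e : 1 + 1 / (N : ℝ) = (N + 1) / N := by field_simp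
  rw [e, hc, div_pow, div_pow, pow_sub₀ _ hN0.ne' hm, pow_sub₀ _ hN1.ne' hN]
  field_simp
  ring

end Limit

/-- fix `m ≥ 1` and reals `0 < x k < 1`. Then the proportion of
minimal factorizations `F` of size `n` such that exactly `m` of the transpositions
move the element `1` and, listing the (1-based) indices of these transpositions in
increasing order as `t 0 < t 1 < ⋯ < t (m-1)`, one has `t k ≤ x k * n` for all `k`,
converges to some `L ≥ 0` as `n → ∞`. The sequence is indexed by `n = nn + 2`;
the element `1` of `{1,…,n}` is the index `0 : Fin n`; a strictly monotone
enumeration `t : Fin m → Fin (n-1)` of the 0-based positions of the transpositions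
moving `1` encodes both that exactly `m` transpositions move `1` and the ordered
list of indices, the 1-based index being `(t k) + 1`. -/
theorem limit_moving_times_exists (m : ℕ) (hm : 1 ≤ m) (x : Fin m → ℝ)
    (hx : ∀ k, 0 < x k ∧ x k < 1) :
    ∃ L : ℝ, 0 ≤ L ∧
      Filter.Tendsto (fun nn : ℕ =>
        (Nat.card {F : Fin ((nn + 2) - 1) → Equiv.Perm (Fin (nn + 2)) //
            IsMinFact (nn + 2) F ∧
            ∃ t : Fin m → Fin ((nn + 2) - 1), StrictMono t ∧
              (∀ k : Fin ((nn + 2) - 1),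
                F k ⟨0, by omega⟩ ≠ ⟨0, by omega⟩ ↔ ∃ l, t l = k) ∧
              ∀ l : Fin m, ((t l : ℕ) + 1 : ℝ) ≤ x l * ((nn + 2 : ℕ) : ℝ)} : ℝ) /
          ((nn + 2 : ℝ) ^ ((nn + 2) - 2)))
        Filter.atTop (nhds L) := by
  have hlim := tendsto_card_moving_times fun k => (hx k).2
  have hexp := (Real.tendsto_one_add_div_pow_exp 1).inv₀ (Real.exp_ne_zero 1)
  have hone : Filter.Tendsto (fun N : ℕ => (1 + 1 / (N : ℝ)) ^ (m + 1)) Filter.atTop (nhds 1) := by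
    simpa using (tendsto_one_div_atTop_nhds_zero_nat (𝕜 := ℝ)).const_add 1 |>.pow (m + 1)
  have hall := (hlim.mul ((hexp.const_mul (m : ℝ)).mul hone)).comp (Filter.tendsto_add_atTop_nat 1)
  refine ⟨_, by positivity, hall.congr' ?_⟩
  filter_upwards [Filter.eventually_ge_atTop m] with nn hnn
  have h := card_isMinFact_moving_times (N := nn + 1)
    fun t : Fin m → Fin (nn + 1) => ∀ l, ((t l : ℕ) + 1 : ℝ) ≤ x l * ((nn + 1 + 1 : ℕ) : ℝ)
  have h' := congrArg (Nat.cast : ℕ → ℝ) h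
  rw [Nat.cast_mul, Nat.cast_mul, Nat.cast_mul, Nat.cast_pow] at h'
  have hn : ((nn : ℝ) + 2) = ((nn + 1 : ℕ) : ℝ) + 1 := by push_cast; ring
  rw [hn]
  refine Eq.trans ?_ (card_div_pow_eq (by omega) (by omega) h').symm
  simp only [Function.comp, Nat.cast_add_one (nn + 1)]
end
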